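/- Berger–Tung inner bound for distributed lossy compression: let (X_1, X_2) be i.i.d. correlated sources with joint pmf p(x_1, x_2) on finite alphabets, with bounded distortion measures d_j : 𝒳_j × 𝒳̂_j → [0, d_{j,max}] for j = 1, 2. A rate pair (R_1, R_2) is achievable with distortions (D_1, D_2) if there exist conditional pmfs p(u_1 | x_1) and p(u_2 | x_2) on finite alphabets and decoding functions x̂_1(u_1, u_2), x̂_2(u_1, u_2) such that E d_j(X_j, X̂_j) ≤ D_j for j = 1, 2 (with U_1 − X_1 − X_2 − U_2) and R_1 > I(X_1; U_1 | U_2), R_2 > I(X_2; U_2 | U_1), and R_1 + R_2 > I(X_1, X_2; U_1, U_2). -/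

import Mathlib

open scoped BigOperators Classical

noncomputable section

/-- `p` is a probability mass function on `α`: nonnegative and summing to one. -/
def IsPmf {α : Type*} (p : α → ℝ) : Prop := (∀ a, 0 ≤ p a) ∧ HasSum p 1

/-- Shannon entropy (base 2) of a pmf. -/
def H2 {α : Type*} (p : α → ℝ) : ℝ := ∑' a, -(p a * Real.logb 2 (p a))

/-- Pushforward (marginalization) of a pmf along a map. -/
def pmap {α β : Type*} (f : α → β) (p : α → ℝ) : β → ℝ :=
  fun b => ∑' a, if f a = b then p a else 0

/-- Mutual information `I(A;B)` (base 2) of a joint pmf on `α × β`. -/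
def MI {α β : Type*} (p : α × β → ℝ) : ℝ :=
  H2 (pmap Prod.fst p) + H2 (pmap Prod.snd p) - H2 p

/-- Conditional mutual information `I(A;B|C)` (base 2) of a joint pmf on `α × β × γ`. -/
def CMI {α β γ : Type*} (p : α × β × γ → ℝ) : ℝ :=
  H2 (pmap (fun a => (a.1, a.2.2)) p) + H2 (pmap Prod.snd p) - H2 p -
    H2 (pmap (fun a => a.2.2) p)

/-- The number of messages `⌈2^{nR}⌉` corresponding to rate `R` at blocklength `n`. -/
def nMsg (n : ℕ) (r : ℝ) : ℕ := ⌈(2 : ℝ) ^ ((n : ℝ) * r)⌉₊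

/-! ### Part A: random binning -/

/-- Average over a uniformly random function `U → K`. -/
def Ew {U K : Type} [Fintype U] [Fintype K] (Φ : (U → K) → ℝ) : ℝ :=
  ∑ ω, (∏ _u : U, (Fintype.card K : ℝ)⁻¹) * Φ ω

section Ew
variable {U K : Type} [Fintype U] [Fintype K]

lemma Ew_w_nonneg : 0 ≤ (∏ _u : U, (Fintype.card K : ℝ)⁻¹) :=
  Finset.prod_nonneg fun _ _ => by positivity

lemma Ew_mono {Φ Ψ : (U → K) → ℝ} (h : ∀ ω, Φ ω ≤ Ψ ω) : Ew Φ ≤ Ew Ψ :=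
  Finset.sum_le_sum fun ω _ => mul_le_mul_of_nonneg_left (h ω) Ew_w_nonneg

lemma Ew_add (Φ Ψ : (U → K) → ℝ) : Ew (fun ω => Φ ω + Ψ ω) = Ew Φ + Ew Ψ := by
  simp only [Ew, mul_add, Finset.sum_add_distrib]

lemma Ew_const_mul (c : ℝ) (Φ : (U → K) → ℝ) : Ew (fun ω => c * Φ ω) = c * Ew Φ := by
  simp only [Ew, Finset.mul_sum]
  exact Finset.sum_congr rfl fun _ _ => by ring

lemma Ew_mul_const (c : ℝ) (Φ : (U → K) → ℝ) : Ew (fun ω => Φ ω * c) = Ew Φ * c := by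
  simp only [Ew, Finset.sum_mul]
  exact Finset.sum_congr rfl fun _ _ => by ring

lemma Ew_sum {ι : Type} (s : Finset ι) (Φ : ι → (U → K) → ℝ) :
    Ew (fun ω => ∑ i ∈ s, Φ i ω) = ∑ i ∈ s, Ew (Φ i) := by
  simp only [Ew, Finset.mul_sum]
  exact Finset.sum_comm

lemma Ew_prod (G : U → K → ℝ) :
    Ew (fun ω => ∏ w, G w (ω w)) = ∏ w, ((Fintype.card K : ℝ)⁻¹ * ∑ k, G w k) := by
  simp only [Ew, ← Finset.prod_mul_distrib, Finset.mul_sum]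
  rw [Finset.prod_univ_sum]
  simp

variable [Nonempty K]

lemma Ew_one (g : K → ℝ) (u : U) :
    Ew (fun ω => g (ω u)) = (Fintype.card K : ℝ)⁻¹ * ∑ k, g k := by
  have := Ew_prod (U := U) (K := K) (fun w k => if w = u then g k else 1)
  simp only [Finset.prod_ite_eq', Finset.mem_univ, if_true] at this
  rw [this]
  have h2 : ∀ w : U, ((Fintype.card K : ℝ)⁻¹ * ∑ k, if w = u then g k else 1)
      = if w = u then ((Fintype.card K : ℝ)⁻¹ * ∑ k, g k) else 1 := by
    intro w; split_ifs <;> simp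
  simp only [h2, Finset.prod_ite_eq', Finset.mem_univ, if_true]

lemma Ew_const [Nonempty U] (c : ℝ) : Ew (fun _ : U → K => c) = c := by
  obtain ⟨u⟩ := ‹Nonempty U›
  rw [Ew_one (fun _ => c) u]; simp

lemma Ew_two (g h : K → ℝ) {u v : U} (huv : u ≠ v) :
    Ew (fun ω => g (ω u) * h (ω v)) =
      ((Fintype.card K : ℝ)⁻¹ * ∑ k, g k) * ((Fintype.card K : ℝ)⁻¹ * ∑ k, h k) := by
  have := Ew_prod (U := U) (K := K)
    (fun w k => (if w = u then g k else 1) * (if w = v then h k else 1))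
  simp only [Finset.prod_mul_distrib, Finset.prod_ite_eq', Finset.mem_univ, if_true] at this
  rw [this, Finset.prod_const, ← Finset.prod_const (s := (Finset.univ : Finset U)),
    ← Finset.prod_mul_distrib]
  have h2 : ∀ w : U, ((Fintype.card K : ℝ)⁻¹ *
        ∑ k, (if w = u then g k else 1) * (if w = v then h k else 1))
      = (if w = u then ((Fintype.card K : ℝ)⁻¹ * ∑ k, g k) else 1) *
        (if w = v then ((Fintype.card K : ℝ)⁻¹ * ∑ k, h k) else 1) := by
    intro w
    by_cases h1 : w = u
    · have h3 : w ≠ v := fun h => huv (h1.symm.trans h)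
      simp [h1, huv]
    · by_cases h3 : w = v <;> simp [h1, h3, huv.symm]
  simp only [h2, Finset.prod_mul_distrib, Finset.prod_ite_eq', Finset.mem_univ, if_true]

lemma Ew_coll {u v : U} (huv : u ≠ v) :
    Ew (fun ω : U → K => if ω u = ω v then (1 : ℝ) else 0) = (Fintype.card K : ℝ)⁻¹ := by
  have : ∀ ω : U → K, (if ω u = ω v then (1 : ℝ) else 0)
      = ∑ k, (if ω u = k then (1 : ℝ) else 0) * (if ω v = k then (1 : ℝ) else 0) := by
    intro ω
    simp only [ite_mul, one_mul, zero_mul, Finset.sum_ite_eq, Finset.mem_univ, if_true]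
    simp [eq_comm]
  simp only [this]
  rw [Ew_sum]
  have h2 : ∀ k : K, Ew (fun ω : U → K => (if ω u = k then (1 : ℝ) else 0) *
      (if ω v = k then (1 : ℝ) else 0)) = (Fintype.card K : ℝ)⁻¹ * (Fintype.card K : ℝ)⁻¹ := by
    intro k
    rw [Ew_two (fun x => if x = k then (1 : ℝ) else 0) (fun x => if x = k then (1 : ℝ) else 0) huv]
    simp
  rw [Finset.sum_congr rfl fun k _ => h2 k]
  simp

lemma exists_le_of_Ew_le [Nonempty U] {Φ : (U → K) → ℝ} {B : ℝ} (h : Ew Φ ≤ B) :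
    ∃ ω, Φ ω ≤ B := by
  by_contra! hc
  have hw : 0 < (∏ _u : U, (Fintype.card K : ℝ)⁻¹) := by
    have : 0 < Fintype.card K := Fintype.card_pos
    exact Finset.prod_pos fun _ _ => by positivity
  have : Ew (fun _ : U → K => B) < Ew Φ := by
    apply Finset.sum_lt_sum_of_nonempty
    · exact Finset.univ_nonempty
    · intro ω _
      exact mul_lt_mul_of_pos_left (hc ω) hw
  rw [Ew_const] at this
  linarith

end Ew

/-- Variance bound for random binning. -/
lemma hash_var {U F M : Type} [Fintype U] [Fintype F] [Fintype M] [Nonempty F] [Nonempty M]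
    (w : U → ℝ) (f : F) :
    Ew (fun ω : U → F × M =>
      (∑ u, w u * ((if (ω u).1 = f then (1 : ℝ) else 0) - (Fintype.card F : ℝ)⁻¹)) ^ 2)
      ≤ (Fintype.card F : ℝ)⁻¹ * ∑ u, w u ^ 2 := by
  have hF : (0 : ℝ) < Fintype.card F := by exact_mod_cast Fintype.card_pos
  have hM : (0 : ℝ) < Fintype.card M := by exact_mod_cast Fintype.card_pos
  set g : F × M → ℝ := fun k => (if k.1 = f then (1 : ℝ) else 0) - (Fintype.card F : ℝ)⁻¹ with hg
  have hsum1 : ∑ k : F × M, (if k.1 = f then (1 : ℝ) else 0) = Fintype.card M := by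
    rw [Fintype.sum_prod_type, Finset.sum_eq_single f]
    · simp
    · intro b _ hb; simp [hb]
    · simp
  have hmean : ∑ k, g k = 0 := by
    simp only [hg, Finset.sum_sub_distrib, hsum1]
    simp; field_simp; simp
  have hsq : (Fintype.card (F × M) : ℝ)⁻¹ * ∑ k, g k * g k ≤ (Fintype.card F : ℝ)⁻¹ := by
    have : ∀ k, g k * g k ≤ (if k.1 = f then (1 : ℝ) else 0) - 2 * (Fintype.card F : ℝ)⁻¹ *
        (if k.1 = f then (1 : ℝ) else 0) + (Fintype.card F : ℝ)⁻¹ * (Fintype.card F : ℝ)⁻¹ := by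
      intro k; simp only [hg]; split_ifs <;> nlinarith
    have h2 := Finset.sum_le_sum (s := Finset.univ) fun k _ => this k
    rw [Finset.sum_add_distrib, Finset.sum_sub_distrib, ← Finset.mul_sum, hsum1] at h2
    simp only [Finset.sum_const, Finset.card_univ, nsmul_eq_mul, Fintype.card_prod] at h2 ⊢
    push_cast at h2 ⊢
    calc _ ≤ ((Fintype.card F : ℝ) * Fintype.card M)⁻¹ * _ :=
          mul_le_mul_of_nonneg_left h2 (by positivity)
      _ = (Fintype.card F : ℝ)⁻¹ - (Fintype.card F : ℝ)⁻¹ * (Fintype.card F : ℝ)⁻¹ := by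
          field_simp; ring
      _ ≤ _ := by
        have : 0 ≤ (Fintype.card F : ℝ)⁻¹ * (Fintype.card F : ℝ)⁻¹ := by positivity
        linarith
  have hexp : ∀ ω : U → F × M, (∑ u, w u * g (ω u)) ^ 2 =
      ∑ u, ∑ v, (w u * w v) * (g (ω u) * g (ω v)) := by
    intro ω
    rw [sq, Finset.sum_mul_sum]
    exact Finset.sum_congr rfl fun u _ => Finset.sum_congr rfl fun v _ => by ring
  change Ew (fun ω : U → F × M => (∑ u, w u * g (ω u)) ^ 2) ≤ _
  simp only [hexp]
  rw [Ew_sum, Finset.mul_sum]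
  apply Finset.sum_le_sum
  intro u _
  rw [Ew_sum, Finset.sum_eq_single u]
  · rw [Ew_const_mul, Ew_one (fun k => g k * g k) u]
    nlinarith [sq_nonneg (w u)]
  · intro v _ hv
    rw [Ew_const_mul, Ew_two g g hv.symm, hmean]; simp
  · simp

/-- Leftover hashing: bins of a random binning are nearly uniform. -/
lemma hash_unif {U F M : Type} [Fintype U] [Fintype F] [Fintype M] [Nonempty F] [Nonempty M]
    [Nonempty U] (w : U → ℝ) (hw : ∀ u, 0 ≤ w u) (hw1 : ∑ u, w u = 1) (τ η : ℝ) (hτ : 0 ≤ τ)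
    (hη : 0 < η) :
    Ew (fun ω : U → F × M =>
      ∑ f, |(Fintype.card F : ℝ)⁻¹ - ∑ u, if (ω u).1 = f then w u else 0|)
      ≤ 2 * (∑ u, if τ < w u then w u else 0) + (η + Fintype.card F * τ * η⁻¹) := by
  have hF : (0 : ℝ) < Fintype.card F := by exact_mod_cast Fintype.card_pos
  set N : ℝ := (Fintype.card F : ℝ) with hN
  set wg : U → ℝ := fun u => if τ < w u then 0 else w u with hwg
  set wb : U → ℝ := fun u => if τ < w u then w u else 0 with hwb
  have hwgb : ∀ u, w u = wg u + wb u := by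
    intro u; simp only [hwg, hwb]; split_ifs <;> simp
  have hwb0 : ∀ u, 0 ≤ wb u := by
    intro u; simp only [hwb]; split_ifs <;> simp [hw]
  set b : (U → F × M) → F → U → ℝ :=
    fun ω f u => (if (ω u).1 = f then (1 : ℝ) else 0) - N⁻¹ with hb
  have key : ∀ ω : U → F × M, (∑ f, |N⁻¹ - ∑ u, if (ω u).1 = f then w u else 0|)
      ≤ 2 * ∑ u, wb u + (η + ∑ f, N * η⁻¹ * (∑ u, wg u * b ω f u) ^ 2) := by
    intro ω
    have h1 : ∀ f, |N⁻¹ - ∑ u, if (ω u).1 = f then w u else 0| ≤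
        (∑ u, wb u * ((if (ω u).1 = f then (1 : ℝ) else 0) + N⁻¹)) +
        (η * N⁻¹ + N * η⁻¹ * (∑ u, wg u * b ω f u) ^ 2) := by
      intro f
      have e1 : (N⁻¹ - ∑ u, if (ω u).1 = f then w u else 0) =
          -(∑ u, wg u * b ω f u) - ∑ u, wb u * b ω f u := by
        have : ∑ u, w u * b ω f u = (∑ u, if (ω u).1 = f then w u else 0) - N⁻¹ := by
          simp only [hb, mul_sub, Finset.sum_sub_distrib, ← Finset.sum_mul, hw1]
          simp
        have h3 : ∑ u, w u * b ω f u = (∑ u, wg u * b ω f u) + ∑ u, wb u * b ω f u := by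
          rw [← Finset.sum_add_distrib]
          exact Finset.sum_congr rfl fun u _ => by rw [hwgb u]; ring
        linarith
      have e2 : |∑ u, wb u * b ω f u| ≤
          ∑ u, wb u * ((if (ω u).1 = f then (1 : ℝ) else 0) + N⁻¹) := by
        refine (Finset.abs_sum_le_sum_abs _ _).trans (Finset.sum_le_sum fun u _ => ?_)
        rw [abs_mul, abs_of_nonneg (hwb0 u)]
        apply mul_le_mul_of_nonneg_left _ (hwb0 u)
        have : 0 < N⁻¹ := by positivity
        simp only [hb]
        rw [abs_le]; split_ifs <;> constructor <;> linarith
      have e3 : ∀ y : ℝ, |y| ≤ η * N⁻¹ + N * η⁻¹ * y ^ 2 := by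
        intro y
        have hc : 0 < η * N⁻¹ := by positivity
        have hc2 : N * η⁻¹ = (η * N⁻¹)⁻¹ := by field_simp
        rw [hc2]
        set c := η * N⁻¹
        have : c + c⁻¹ * y ^ 2 - |y| = c⁻¹ * (c ^ 2 + |y| ^ 2 - c * |y|) := by
          rw [sq_abs]; field_simp
        have h0 : 0 ≤ c⁻¹ * (c ^ 2 + |y| ^ 2 - c * |y|) := by
          apply mul_nonneg (by positivity)
          nlinarith [sq_nonneg (c - |y|), sq_nonneg c, sq_nonneg |y|]
        linarith
      rw [e1]
      calc _ ≤ |-(∑ u, wg u * b ω f u)| + |∑ u, wb u * b ω f u| := abs_sub _ _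
        _ ≤ _ := by rw [abs_neg]; linarith [e3 (∑ u, wg u * b ω f u)]
    refine (Finset.sum_le_sum fun f _ => h1 f).trans ?_
    rw [Finset.sum_add_distrib, Finset.sum_add_distrib, Finset.sum_comm]
    have e4 : ∀ u, ∑ f, wb u * ((if (ω u).1 = f then (1 : ℝ) else 0) + N⁻¹) = 2 * wb u := by
      intro u
      rw [← Finset.mul_sum, Finset.sum_add_distrib]
      simp [← hN]; field_simp; norm_num
    simp only [e4, ← Finset.mul_sum]
    simp [← hN]
  refine (Ew_mono key).trans ?_
  rw [Ew_add, Ew_add, Ew_const, Ew_const, Ew_sum]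
  gcongr
  have h5 : ∀ f, Ew (fun ω : U → F × M => N * η⁻¹ * (∑ u, wg u * b ω f u) ^ 2) ≤ η⁻¹ * τ := by
    intro f
    rw [Ew_const_mul]
    have h6 := hash_var (M := M) wg f
    have h7 : ∑ u, wg u ^ 2 ≤ τ := by
      calc ∑ u, wg u ^ 2 ≤ ∑ u, τ * w u := by
            apply Finset.sum_le_sum; intro u _
            simp only [hwg]; split_ifs with h
            · simpa using mul_nonneg hτ (hw u)
            · nlinarith [hw u, not_lt.1 h]
        _ = τ := by rw [← Finset.mul_sum, hw1, mul_one]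
    calc _ ≤ N * η⁻¹ * (N⁻¹ * τ) := by
          apply mul_le_mul_of_nonneg_left _ (by positivity)
          exact h6.trans (mul_le_mul_of_nonneg_left h7 (by positivity))
      _ = _ := by field_simp
  refine (Finset.sum_le_sum fun f _ => h5 f).trans ?_
  simp [← hN]; apply le_of_eq; ring

/-! ### Part B: the one-shot bound -/

/-- The indicator of a proposition. -/
def ind (q : Prop) : ℝ := if q then 1 else 0

lemma ind_nonneg (q : Prop) : 0 ≤ ind q := by unfold ind; split_ifs <;> norm_num
lemma ind_le_one (q : Prop) : ind q ≤ 1 := by unfold ind; split_ifs <;> norm_num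
lemma ind_true {q : Prop} (h : q) : ind q = 1 := if_pos h
lemma ind_false {q : Prop} (h : ¬ q) : ind q = 0 := if_neg h

/-- Mass of bin `f`. -/
def binMass {U F : Type} [Fintype U] (k : U → ℝ) (φ : U → F) (f : F) : ℝ :=
  ∑ u, if φ u = f then k u else 0

/-- Conditional law of `u` given that its bin is `f`. -/
def encU {U F : Type} [Fintype U] [Nonempty U] (k : U → ℝ) (φ : U → F) (f : F) (u : U) : ℝ :=
  if binMass k φ f = 0 then (if u = Classical.arbitrary U then 1 else 0)
  else (if φ u = f then k u else 0) / binMass k φ f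

section enc
variable {U F : Type} [Fintype U] (k : U → ℝ)

lemma binMass_nonneg (hk : ∀ u, 0 ≤ k u) (φ : U → F) (f : F) : 0 ≤ binMass k φ f :=
  Finset.sum_nonneg fun u _ => by split_ifs <;> simp [hk]

lemma binMass_sum [Fintype F] (φ : U → F) : ∑ f, binMass k φ f = ∑ u, k u := by
  unfold binMass
  rw [Finset.sum_comm]
  simp

lemma encU_nonneg [Nonempty U] (hk : ∀ u, 0 ≤ k u) (φ : U → F) (f : F) (u : U) : 0 ≤ encU k φ f u := by
  unfold encU
  split_ifs
  · norm_num
  · norm_num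
  · exact div_nonneg (hk u) (binMass_nonneg k hk φ f)
  · simp

lemma encU_sum [Nonempty U] (φ : U → F) (f : F) : ∑ u, encU k φ f u = 1 := by
  unfold encU
  split_ifs with h
  · simp
  · rw [← Finset.sum_div]
    exact div_self h

lemma encU_mul [Nonempty U] (hk : ∀ u, 0 ≤ k u) (φ : U → F) (f : F) (u : U) :
    binMass k φ f * encU k φ f u = if φ u = f then k u else 0 := by
  unfold encU
  split_ifs with h h1 h2 h2
  · rw [h, zero_mul]
    have := (Finset.sum_eq_zero_iff_of_nonneg (s := Finset.univ)
      (f := fun u => if φ u = f then k u else 0)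
      fun u _ => by split_ifs <;> simp [hk]).1 h u (Finset.mem_univ _)
    simpa [h2] using this.symm
  · rw [h, zero_mul]
  · rw [h, zero_mul]
    have := (Finset.sum_eq_zero_iff_of_nonneg (s := Finset.univ)
      (f := fun u => if φ u = f then k u else 0)
      fun u _ => by split_ifs <;> simp [hk]).1 h u (Finset.mem_univ _)
    simpa [h2] using this.symm
  · rw [h, zero_mul]
  · field_simp
  · simp

end enc

/-- Comparison of the operational law with the ideal law. -/
lemma tv_bound {U₁ U₂ F₁ F₂ : Type} [Fintype U₁] [Fintype U₂] [Fintype F₁] [Fintype F₂]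
    [Nonempty U₁] [Nonempty U₂] [Nonempty F₁] [Nonempty F₂]
    (k₁ : U₁ → ℝ) (k₂ : U₂ → ℝ) (hk₁ : ∀ u, 0 ≤ k₁ u) (hk₂ : ∀ u, 0 ≤ k₂ u)
    (hs₁ : ∑ u, k₁ u = 1) (φ₁ : U₁ → F₁) (φ₂ : U₂ → F₂)
    (h : F₁ → F₂ → U₁ → U₂ → ℝ) (h0 : ∀ a b c d, 0 ≤ h a b c d) (h1 : ∀ a b c d, h a b c d ≤ 1) :
    ∑ f₁, ∑ f₂, (Fintype.card F₁ : ℝ)⁻¹ * ((Fintype.card F₂ : ℝ)⁻¹ *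
      ∑ u₁, ∑ u₂, encU k₁ φ₁ f₁ u₁ * encU k₂ φ₂ f₂ u₂ * h f₁ f₂ u₁ u₂) ≤
    (∑ u₁, ∑ u₂, k₁ u₁ * k₂ u₂ * h (φ₁ u₁) (φ₂ u₂) u₁ u₂) +
      ((∑ f, |(Fintype.card F₁ : ℝ)⁻¹ - binMass k₁ φ₁ f|) +
       (∑ f, |(Fintype.card F₂ : ℝ)⁻¹ - binMass k₂ φ₂ f|)) := by
  have hF₁ : (0 : ℝ) < Fintype.card F₁ := by exact_mod_cast Fintype.card_pos
  have hF₂ : (0 : ℝ) < Fintype.card F₂ := by exact_mod_cast Fintype.card_pos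
  set a : ℝ := (Fintype.card F₁ : ℝ)⁻¹ with ha
  set b : ℝ := (Fintype.card F₂ : ℝ)⁻¹ with hb
  have hb0 : 0 < b := by positivity
  have pt : ∀ f₁ f₂ u₁ u₂,
      a * (b * (encU k₁ φ₁ f₁ u₁ * encU k₂ φ₂ f₂ u₂ * h f₁ f₂ u₁ u₂)) ≤
      (if φ₁ u₁ = f₁ then k₁ u₁ else 0) * (if φ₂ u₂ = f₂ then k₂ u₂ else 0) * h f₁ f₂ u₁ u₂ +
      (|a - binMass k₁ φ₁ f₁| * b + binMass k₁ φ₁ f₁ * |b - binMass k₂ φ₂ f₂|) *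
        (encU k₁ φ₁ f₁ u₁ * encU k₂ φ₂ f₂ u₂) := by
    intro f₁ f₂ u₁ u₂
    rw [← encU_mul k₁ hk₁, ← encU_mul k₂ hk₂]
    have e1 := encU_nonneg k₁ hk₁ φ₁ f₁ u₁
    have e2 := encU_nonneg k₂ hk₂ φ₂ f₂ u₂
    have s1 := binMass_nonneg k₁ hk₁ φ₁ f₁
    set s := binMass k₁ φ₁ f₁
    set t := binMass k₂ φ₂ f₂
    set x := encU k₁ φ₁ f₁ u₁
    set y := encU k₂ φ₂ f₂ u₂
    have hz0 := h0 f₁ f₂ u₁ u₂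
    have hz1 := h1 f₁ f₂ u₁ u₂
    set z := h f₁ f₂ u₁ u₂
    have hxy : 0 ≤ x * y := mul_nonneg e1 e2
    have hD : a * b - s * t ≤ |a - s| * b + s * |b - t| := by
      have : a * b - s * t = (a - s) * b + s * (b - t) := by ring
      rw [this]
      exact add_le_add (mul_le_mul_of_nonneg_right (le_abs_self _) hb0.le)
        (mul_le_mul_of_nonneg_left (le_abs_self _) s1)
    have hDn : 0 ≤ |a - s| * b + s * |b - t| := by positivity
    have : (a * b - s * t) * z ≤ |a - s| * b + s * |b - t| := by nlinarith
    nlinarith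
  have hsum : ∑ f₁, ∑ f₂, a * (b * ∑ u₁, ∑ u₂, encU k₁ φ₁ f₁ u₁ * encU k₂ φ₂ f₂ u₂ *
      h f₁ f₂ u₁ u₂) = ∑ f₁, ∑ f₂, ∑ u₁, ∑ u₂, a * (b * (encU k₁ φ₁ f₁ u₁ *
        encU k₂ φ₂ f₂ u₂ * h f₁ f₂ u₁ u₂)) := by
    simp only [Finset.mul_sum]
  rw [hsum]
  refine (Finset.sum_le_sum fun f₁ _ => Finset.sum_le_sum fun f₂ _ => Finset.sum_le_sum
    fun u₁ _ => Finset.sum_le_sum fun u₂ _ => pt f₁ f₂ u₁ u₂).trans ?_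
  simp only [Finset.sum_add_distrib]
  apply add_le_add
  · apply le_of_eq
    have sw : ∀ G : F₁ → F₂ → U₁ → U₂ → ℝ, ∑ f₁, ∑ f₂, ∑ u₁, ∑ u₂, G f₁ f₂ u₁ u₂ =
        ∑ u₁, ∑ u₂, ∑ f₁, ∑ f₂, G f₁ f₂ u₁ u₂ := by
      intro G
      calc _ = ∑ f₁, ∑ u₁, ∑ f₂, ∑ u₂, G f₁ f₂ u₁ u₂ :=
            Finset.sum_congr rfl fun _ _ => Finset.sum_comm
        _ = ∑ u₁, ∑ f₁, ∑ f₂, ∑ u₂, G f₁ f₂ u₁ u₂ := Finset.sum_comm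
        _ = ∑ u₁, ∑ f₁, ∑ u₂, ∑ f₂, G f₁ f₂ u₁ u₂ :=
            Finset.sum_congr rfl fun _ _ => Finset.sum_congr rfl fun _ _ => Finset.sum_comm
        _ = _ := Finset.sum_congr rfl fun _ _ => Finset.sum_comm
    rw [sw]
    refine Finset.sum_congr rfl fun u₁ _ => Finset.sum_congr rfl fun u₂ _ => ?_
    simp only [ite_mul, mul_ite, zero_mul, mul_zero, Finset.sum_ite_eq, Finset.mem_univ, if_true]
  · apply le_of_eq
    have e : ∀ f₁ f₂, ∑ u₁, ∑ u₂, (|a - binMass k₁ φ₁ f₁| * b +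
        binMass k₁ φ₁ f₁ * |b - binMass k₂ φ₂ f₂|) *
        (encU k₁ φ₁ f₁ u₁ * encU k₂ φ₂ f₂ u₂) = |a - binMass k₁ φ₁ f₁| * b +
        binMass k₁ φ₁ f₁ * |b - binMass k₂ φ₂ f₂| := by
      intro f₁ f₂
      simp only [← Finset.mul_sum, encU_sum, mul_one]
    rw [Finset.sum_congr rfl fun f₁ _ => Finset.sum_congr rfl fun f₂ _ => e f₁ f₂]
    have hb1 : ∑ _f : F₂, b = 1 := by simp [hb]
    simp only [Finset.sum_add_distrib, ← Finset.mul_sum, ← Finset.sum_mul, binMass_sum, hs₁,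
      one_mul, hb1, mul_one]

/-- Slepian–Wolf decoder for bins `ω₁, ω₂` and candidate set `T`. -/
def swDec {U₁ U₂ K₁ K₂ : Type} [Nonempty U₁] [Nonempty U₂] (T : U₁ → U₂ → Prop)
    (ω₁ : U₁ → K₁) (ω₂ : U₂ → K₂) (κ₁ : K₁) (κ₂ : K₂) : U₁ × U₂ :=
  if h : ∃ v : U₁ × U₂, T v.1 v.2 ∧ ω₁ v.1 = κ₁ ∧ ω₂ v.2 = κ₂ then h.choose
  else Classical.arbitrary _

/-- Number of colliding competitors. -/
def swColl {U₁ U₂ K₁ K₂ : Type} [Fintype U₁] [Fintype U₂] (T : U₁ → U₂ → Prop)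
    (ω₁ : U₁ → K₁) (ω₂ : U₂ → K₂) (u₁ : U₁) (u₂ : U₂) : ℝ :=
  ∑ v₁, ∑ v₂, ind (T v₁ v₂) * ind (¬ (v₁ = u₁ ∧ v₂ = u₂)) *
    ((if ω₁ v₁ = ω₁ u₁ then 1 else 0) * (if ω₂ v₂ = ω₂ u₂ then 1 else 0))

lemma swDec_bound {U₁ U₂ K₁ K₂ : Type} [Fintype U₁] [Fintype U₂] [Nonempty U₁] [Nonempty U₂]
    (T : U₁ → U₂ → Prop) (ω₁ : U₁ → K₁) (ω₂ : U₂ → K₂) (u₁ : U₁) (u₂ : U₂)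
    (B : U₁ → U₂ → Prop) :
    ind (B (swDec T ω₁ ω₂ (ω₁ u₁) (ω₂ u₂)).1 (swDec T ω₁ ω₂ (ω₁ u₁) (ω₂ u₂)).2) ≤
      ind (B u₁ u₂ ∨ ¬ T u₁ u₂) + swColl T ω₁ ω₂ u₁ u₂ := by
  have hterm : ∀ v₁ v₂, 0 ≤ ind (T v₁ v₂) * ind (¬ (v₁ = u₁ ∧ v₂ = u₂)) *
    ((if ω₁ v₁ = ω₁ u₁ then (1 : ℝ) else 0) * (if ω₂ v₂ = ω₂ u₂ then 1 else 0)) := by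
    intro v₁ v₂
    apply mul_nonneg (mul_nonneg (ind_nonneg _) (ind_nonneg _))
    split_ifs <;> norm_num
  have hc0 : 0 ≤ swColl T ω₁ ω₂ u₁ u₂ :=
    Finset.sum_nonneg fun v₁ _ => Finset.sum_nonneg fun v₂ _ => hterm v₁ v₂
  by_cases hT : T u₁ u₂
  · have hex : ∃ v : U₁ × U₂, T v.1 v.2 ∧ ω₁ v.1 = ω₁ u₁ ∧ ω₂ v.2 = ω₂ u₂ :=
      ⟨(u₁, u₂), hT, rfl, rfl⟩
    have hd : swDec T ω₁ ω₂ (ω₁ u₁) (ω₂ u₂) = hex.choose := dif_pos hex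
    obtain ⟨c1, c2, c3⟩ := hex.choose_spec
    rw [← hd] at c1 c2 c3
    set v := swDec T ω₁ ω₂ (ω₁ u₁) (ω₂ u₂)
    by_cases hv : v.1 = u₁ ∧ v.2 = u₂
    · rw [hv.1, hv.2]
      have : ind (B u₁ u₂) ≤ ind (B u₁ u₂ ∨ ¬ T u₁ u₂) := by
        by_cases hB : B u₁ u₂
        · rw [ind_true hB, ind_true (Or.inl hB)]
        · rw [ind_false hB]; exact ind_nonneg _
      linarith
    · have : 1 ≤ swColl T ω₁ ω₂ u₁ u₂ := by
        have h1 := Finset.single_le_sum (f := fun v₂ => ind (T v.1 v₂) *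
          ind (¬ (v.1 = u₁ ∧ v₂ = u₂)) *
          ((if ω₁ v.1 = ω₁ u₁ then (1 : ℝ) else 0) * (if ω₂ v₂ = ω₂ u₂ then 1 else 0)))
          (fun v₂ _ => hterm v.1 v₂) (Finset.mem_univ v.2)
        have h2 := Finset.single_le_sum (f := fun v₁ => ∑ v₂, ind (T v₁ v₂) *
          ind (¬ (v₁ = u₁ ∧ v₂ = u₂)) *
          ((if ω₁ v₁ = ω₁ u₁ then (1 : ℝ) else 0) * (if ω₂ v₂ = ω₂ u₂ then 1 else 0)))
          (fun v₁ _ => Finset.sum_nonneg fun v₂ _ => hterm v₁ v₂) (Finset.mem_univ v.1)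
        have h3 := h1.trans h2
        simp only [ind_true c1, ind_true hv, c2, c3, if_true, mul_one] at h3
        exact h3
      linarith [ind_le_one (B v.1 v.2), ind_nonneg (B u₁ u₂ ∨ ¬ T u₁ u₂)]
  · rw [ind_true (q := B u₁ u₂ ∨ ¬ T u₁ u₂) (Or.inr hT)]
    linarith [ind_le_one (B (swDec T ω₁ ω₂ (ω₁ u₁) (ω₂ u₂)).1 (swDec T ω₁ ω₂ (ω₁ u₁) (ω₂ u₂)).2)]

lemma swColl_avg {U₁ U₂ K₁ K₂ : Type} [Fintype U₁] [Fintype U₂] [Fintype K₁] [Fintype K₂]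
    [Nonempty U₁] [Nonempty U₂] [Nonempty K₁] [Nonempty K₂]
    (T : U₁ → U₂ → Prop) (L₁ L₂ L : ℝ)
    (hL₁ : ∀ u₂, ∑ u₁, ind (T u₁ u₂) ≤ L₁) (hL₂ : ∀ u₁, ∑ u₂, ind (T u₁ u₂) ≤ L₂)
    (hL : ∑ u₁, ∑ u₂, ind (T u₁ u₂) ≤ L) (u₁ : U₁) (u₂ : U₂) :
    Ew (fun ω₁ : U₁ → K₁ => Ew (fun ω₂ : U₂ → K₂ => swColl T ω₁ ω₂ u₁ u₂)) ≤
      L₁ * (Fintype.card K₁ : ℝ)⁻¹ + L₂ * (Fintype.card K₂ : ℝ)⁻¹ +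
        L * ((Fintype.card K₁ : ℝ)⁻¹ * (Fintype.card K₂ : ℝ)⁻¹) := by
  set a := (Fintype.card K₁ : ℝ)⁻¹
  set b := (Fintype.card K₂ : ℝ)⁻¹
  have ha : 0 ≤ a := by positivity
  have hb : 0 ≤ b := by positivity
  simp only [swColl, Ew_sum, Ew_const_mul, Ew_mul_const]
  have hc : ∀ v₁ v₂, ind (T v₁ v₂) * ind (¬ (v₁ = u₁ ∧ v₂ = u₂)) *
      (Ew (fun ω₁ : U₁ → K₁ => if ω₁ v₁ = ω₁ u₁ then 1 else 0) *
        Ew (fun ω₂ : U₂ → K₂ => if ω₂ v₂ = ω₂ u₂ then 1 else 0)) ≤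
      (if v₂ = u₂ then ind (T v₁ v₂) else 0) * a + (if v₁ = u₁ then ind (T v₁ v₂) else 0) * b +
        ind (T v₁ v₂) * (a * b) := by
    intro v₁ v₂
    have hT := ind_nonneg (T v₁ v₂)
    set t := ind (T v₁ v₂)
    have hab : 0 ≤ t * (a * b) := by positivity
    have hta : 0 ≤ t * a := by positivity
    have htb : 0 ≤ t * b := by positivity
    by_cases h1 : v₁ = u₁ <;> by_cases h2 : v₂ = u₂
    · rw [ind_false (by tauto)]
      simp only [h1, h2, if_true]
      linarith
    · rw [Ew_coll h2]
      simp only [h1, h2, if_true, if_false, Ew_const, ind_true, and_false, not_false_iff]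
      linarith
    · rw [Ew_coll h1]
      simp only [h1, h2, if_true, if_false, Ew_const, ind_true, false_and, not_false_iff]
      linarith
    · rw [Ew_coll h1, Ew_coll h2]
      simp only [h1, h2, if_false, ind_true, false_and, not_false_iff]
      linarith
  refine (Finset.sum_le_sum fun v₁ _ => Finset.sum_le_sum fun v₂ _ => hc v₁ v₂).trans ?_
  simp only [Finset.sum_add_distrib, ← Finset.sum_mul]
  gcongr
  · simpa using hL₁ u₂
  · rw [Finset.sum_eq_single u₁]
    · simpa using hL₂ u₁
    · intro c _ hc; simp [hc]
    · simp

lemma exists_le_of_avg_le {F : Type} [Fintype F] [Nonempty F] {g : F → ℝ} {B : ℝ}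
    (h : ∑ f, (Fintype.card F : ℝ)⁻¹ * g f ≤ B) : ∃ f, g f ≤ B := by
  by_contra! hc
  have hF : (0 : ℝ) < Fintype.card F := by exact_mod_cast Fintype.card_pos
  have : ∑ _f : F, (Fintype.card F : ℝ)⁻¹ * B < ∑ f, (Fintype.card F : ℝ)⁻¹ * g f := by
    apply Finset.sum_lt_sum_of_nonempty Finset.univ_nonempty
    intro f _
    exact mul_lt_mul_of_pos_left (hc f) (by positivity)
  have h2 : ∑ _f : F, (Fintype.card F : ℝ)⁻¹ * B = B := by
    simp
  linarith

/-- One-shot achievability. -/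
theorem oneshot {X₁ X₂ U₁ U₂ F₁ F₂ M₁ M₂ : Type} [Fintype X₁] [Fintype X₂]
    [Fintype U₁] [Fintype U₂] [Fintype F₁] [Fintype F₂] [Fintype M₁] [Fintype M₂]
    [Nonempty U₁] [Nonempty U₂] [Nonempty F₁] [Nonempty F₂] [Nonempty M₁] [Nonempty M₂]
    (p : X₁ × X₂ → ℝ) (hp : ∀ x, 0 ≤ p x) (hp1 : ∑ x, p x = 1)
    (k₁ : X₁ → U₁ → ℝ) (k₂ : X₂ → U₂ → ℝ) (hk₁ : ∀ x u, 0 ≤ k₁ x u) (hk₂ : ∀ x u, 0 ≤ k₂ x u)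
    (hs₁ : ∀ x, ∑ u, k₁ x u = 1) (hs₂ : ∀ x, ∑ u, k₂ x u = 1)
    (T : U₁ → U₂ → Prop) (L₁ L₂ L : ℝ)
    (hL₁ : ∀ u₂, ∑ u₁, ind (T u₁ u₂) ≤ L₁) (hL₂ : ∀ u₁, ∑ u₂, ind (T u₁ u₂) ≤ L₂)
    (hL : ∑ u₁, ∑ u₂, ind (T u₁ u₂) ≤ L) (θ₁ θ₂ : ℝ)
    (hθ₁ : ∑ x : X₁ × X₂, p x * Ew (fun ω : U₁ → F₁ × M₁ =>
      ∑ f, |(Fintype.card F₁ : ℝ)⁻¹ - ∑ u, if (ω u).1 = f then k₁ x.1 u else 0|) ≤ θ₁)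
    (hθ₂ : ∑ x : X₁ × X₂, p x * Ew (fun ω : U₂ → F₂ × M₂ =>
      ∑ f, |(Fintype.card F₂ : ℝ)⁻¹ - ∑ u, if (ω u).1 = f then k₂ x.2 u else 0|) ≤ θ₂)
    (Bd : X₁ × X₂ → U₁ → U₂ → Prop) :
    ∃ (e₁ : X₁ → M₁ → ℝ) (e₂ : X₂ → M₂ → ℝ) (dec : M₁ → M₂ → U₁ × U₂),
      (∀ x m, 0 ≤ e₁ x m) ∧ (∀ x, ∑ m, e₁ x m = 1) ∧
      (∀ x m, 0 ≤ e₂ x m) ∧ (∀ x, ∑ m, e₂ x m = 1) ∧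
      ∑ x : X₁ × X₂, p x * ∑ m₁, ∑ m₂, e₁ x.1 m₁ * e₂ x.2 m₂ *
        ind (Bd x (dec m₁ m₂).1 (dec m₁ m₂).2) ≤
      (∑ x : X₁ × X₂, p x * ∑ u₁, ∑ u₂, k₁ x.1 u₁ * k₂ x.2 u₂ * ind (Bd x u₁ u₂ ∨ ¬ T u₁ u₂)) +
      (L₁ * (Fintype.card (F₁ × M₁) : ℝ)⁻¹ + L₂ * (Fintype.card (F₂ × M₂) : ℝ)⁻¹ +
        L * ((Fintype.card (F₁ × M₁) : ℝ)⁻¹ * (Fintype.card (F₂ × M₂) : ℝ)⁻¹)) + (θ₁ + θ₂) := by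
  set B₀ := (∑ x : X₁ × X₂, p x * ∑ u₁, ∑ u₂, k₁ x.1 u₁ * k₂ x.2 u₂ *
    ind (Bd x u₁ u₂ ∨ ¬ T u₁ u₂)) with hB₀
  set Λ := (L₁ * (Fintype.card (F₁ × M₁) : ℝ)⁻¹ + L₂ * (Fintype.card (F₂ × M₂) : ℝ)⁻¹ +
        L * ((Fintype.card (F₁ × M₁) : ℝ)⁻¹ * (Fintype.card (F₂ × M₂) : ℝ)⁻¹)) with hΛ
  -- error functional for given bins and shared bin indices
  set h : (U₁ → F₁ × M₁) → (U₂ → F₂ × M₂) → X₁ × X₂ → F₁ → F₂ → U₁ → U₂ → ℝ :=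
    fun ω₁ ω₂ x f₁ f₂ u₁ u₂ =>
      ind (Bd x (swDec T ω₁ ω₂ (f₁, (ω₁ u₁).2) (f₂, (ω₂ u₂).2)).1
        (swDec T ω₁ ω₂ (f₁, (ω₁ u₁).2) (f₂, (ω₂ u₂).2)).2) with hh
  set R : (U₁ → F₁ × M₁) → (U₂ → F₂ × M₂) → F₁ → F₂ → ℝ := fun ω₁ ω₂ f₁ f₂ =>
    ∑ x : X₁ × X₂, p x * ∑ u₁, ∑ u₂, encU (k₁ x.1) (fun u => (ω₁ u).1) f₁ u₁ *
      encU (k₂ x.2) (fun u => (ω₂ u).1) f₂ u₂ * h ω₁ ω₂ x f₁ f₂ u₁ u₂ with hR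
  set Δ₁ : (U₁ → F₁ × M₁) → X₁ × X₂ → ℝ := fun ω x =>
    ∑ f, |(Fintype.card F₁ : ℝ)⁻¹ - ∑ u, if (ω u).1 = f then k₁ x.1 u else 0| with hΔ₁
  set Δ₂ : (U₂ → F₂ × M₂) → X₁ × X₂ → ℝ := fun ω x =>
    ∑ f, |(Fintype.card F₂ : ℝ)⁻¹ - ∑ u, if (ω u).1 = f then k₂ x.2 u else 0| with hΔ₂
  have step1 : ∀ ω₁ ω₂, ∑ f₁, (Fintype.card F₁ : ℝ)⁻¹ * ∑ f₂, (Fintype.card F₂ : ℝ)⁻¹ *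
      R ω₁ ω₂ f₁ f₂ ≤ B₀ + (∑ x : X₁ × X₂, ∑ u₁, ∑ u₂, (p x * (k₁ x.1 u₁ * k₂ x.2 u₂)) *
        swColl T ω₁ ω₂ u₁ u₂) + (∑ x, p x * Δ₁ ω₁ x + ∑ x, p x * Δ₂ ω₂ x) := by
    intro ω₁ ω₂
    have e1 : ∑ f₁, (Fintype.card F₁ : ℝ)⁻¹ * ∑ f₂, (Fintype.card F₂ : ℝ)⁻¹ * R ω₁ ω₂ f₁ f₂ =
        ∑ x, p x * ∑ f₁, ∑ f₂, (Fintype.card F₁ : ℝ)⁻¹ * ((Fintype.card F₂ : ℝ)⁻¹ *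
          ∑ u₁, ∑ u₂, encU (k₁ x.1) (fun u => (ω₁ u).1) f₁ u₁ *
            encU (k₂ x.2) (fun u => (ω₂ u).1) f₂ u₂ * h ω₁ ω₂ x f₁ f₂ u₁ u₂) := by
      have : ∀ x, p x * ∑ f₁, ∑ f₂, (Fintype.card F₁ : ℝ)⁻¹ * ((Fintype.card F₂ : ℝ)⁻¹ *
          ∑ u₁, ∑ u₂, encU (k₁ x.1) (fun u => (ω₁ u).1) f₁ u₁ *
            encU (k₂ x.2) (fun u => (ω₂ u).1) f₂ u₂ * h ω₁ ω₂ x f₁ f₂ u₁ u₂) =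
          ∑ f₁, ∑ f₂, (Fintype.card F₁ : ℝ)⁻¹ * ((Fintype.card F₂ : ℝ)⁻¹ * (p x *
          ∑ u₁, ∑ u₂, encU (k₁ x.1) (fun u => (ω₁ u).1) f₁ u₁ *
            encU (k₂ x.2) (fun u => (ω₂ u).1) f₂ u₂ * h ω₁ ω₂ x f₁ f₂ u₁ u₂)) := by
        intro x
        rw [Finset.mul_sum]
        refine Finset.sum_congr rfl fun f₁ _ => ?_
        rw [Finset.mul_sum]
        refine Finset.sum_congr rfl fun f₂ _ => ?_
        ring
      rw [Finset.sum_congr rfl fun x _ => this x, Finset.sum_comm]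
      refine Finset.sum_congr rfl fun f₁ _ => ?_
      rw [Finset.sum_comm, Finset.mul_sum]
      refine Finset.sum_congr rfl fun f₂ _ => ?_
      rw [← Finset.mul_sum, ← Finset.mul_sum]
    rw [e1]
    have e2 : ∀ x : X₁ × X₂, p x * ∑ f₁, ∑ f₂, (Fintype.card F₁ : ℝ)⁻¹ * ((Fintype.card F₂ : ℝ)⁻¹ *
          ∑ u₁, ∑ u₂, encU (k₁ x.1) (fun u => (ω₁ u).1) f₁ u₁ *
            encU (k₂ x.2) (fun u => (ω₂ u).1) f₂ u₂ * h ω₁ ω₂ x f₁ f₂ u₁ u₂) ≤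
        (p x * ∑ u₁, ∑ u₂, k₁ x.1 u₁ * k₂ x.2 u₂ * ind (Bd x u₁ u₂ ∨ ¬ T u₁ u₂)) +
        (∑ u₁, ∑ u₂, (p x * (k₁ x.1 u₁ * k₂ x.2 u₂)) * swColl T ω₁ ω₂ u₁ u₂) +
        (p x * Δ₁ ω₁ x + p x * Δ₂ ω₂ x) := by
      intro x
      have t := tv_bound (k₁ x.1) (k₂ x.2) (hk₁ _) (hk₂ _) (hs₁ _) (fun u => (ω₁ u).1)
        (fun u => (ω₂ u).1) (h ω₁ ω₂ x) (fun _ _ _ _ => ind_nonneg _) (fun _ _ _ _ => ind_le_one _)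
      have t2 : (∑ u₁, ∑ u₂, k₁ x.1 u₁ * k₂ x.2 u₂ * h ω₁ ω₂ x (ω₁ u₁).1 (ω₂ u₂).1 u₁ u₂) ≤
          (∑ u₁, ∑ u₂, k₁ x.1 u₁ * k₂ x.2 u₂ * ind (Bd x u₁ u₂ ∨ ¬ T u₁ u₂)) +
          (∑ u₁, ∑ u₂, (k₁ x.1 u₁ * k₂ x.2 u₂) * swColl T ω₁ ω₂ u₁ u₂) := by
        rw [← Finset.sum_add_distrib]
        refine Finset.sum_le_sum fun u₁ _ => ?_
        rw [← Finset.sum_add_distrib]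
        refine Finset.sum_le_sum fun u₂ _ => ?_
        rw [← mul_add]
        exact mul_le_mul_of_nonneg_left (swDec_bound T ω₁ ω₂ u₁ u₂ (Bd x))
          (mul_nonneg (hk₁ _ _) (hk₂ _ _))
      have t3 := mul_le_mul_of_nonneg_left (t.trans (add_le_add_left t2 _)) (hp x)
      refine t3.trans (le_of_eq ?_)
      have : (∑ u₁, ∑ u₂, (p x * (k₁ x.1 u₁ * k₂ x.2 u₂)) * swColl T ω₁ ω₂ u₁ u₂) =
          p x * (∑ u₁, ∑ u₂, (k₁ x.1 u₁ * k₂ x.2 u₂) * swColl T ω₁ ω₂ u₁ u₂) := by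
        simp only [Finset.mul_sum, mul_assoc]
      rw [this]
      simp only [hΔ₁, hΔ₂, binMass]
      ring
    refine (Finset.sum_le_sum fun x _ => e2 x).trans (le_of_eq ?_)
    simp only [Finset.sum_add_distrib, hB₀]
  have step2 : Ew (fun ω₁ => Ew (fun ω₂ => ∑ f₁, (Fintype.card F₁ : ℝ)⁻¹ *
      ∑ f₂, (Fintype.card F₂ : ℝ)⁻¹ * R ω₁ ω₂ f₁ f₂)) ≤ B₀ + Λ + (θ₁ + θ₂) := by
    refine (Ew_mono fun ω₁ => Ew_mono fun ω₂ => step1 ω₁ ω₂).trans ?_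
    simp only [Ew_add, Ew_const, Ew_sum, Ew_const_mul]
    gcongr
    calc _ ≤ ∑ x : X₁ × X₂, ∑ u₁, ∑ u₂, (p x * (k₁ x.1 u₁ * k₂ x.2 u₂)) * Λ := by
          refine Finset.sum_le_sum fun x _ => Finset.sum_le_sum fun u₁ _ =>
            Finset.sum_le_sum fun u₂ _ => ?_
          exact mul_le_mul_of_nonneg_left (swColl_avg T L₁ L₂ L hL₁ hL₂ hL u₁ u₂)
            (mul_nonneg (hp x) (mul_nonneg (hk₁ _ _) (hk₂ _ _)))
      _ = Λ := by
          simp only [← Finset.sum_mul, ← Finset.mul_sum, hs₁, hs₂, mul_one, hp1, one_mul]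
  obtain ⟨ω₁, h1⟩ := exists_le_of_Ew_le step2
  obtain ⟨ω₂, h2⟩ := exists_le_of_Ew_le h1
  obtain ⟨f₁, h3⟩ := exists_le_of_avg_le h2
  obtain ⟨f₂, h4⟩ := exists_le_of_avg_le h3
  refine ⟨fun x m => ∑ u, if (ω₁ u).2 = m then encU (k₁ x) (fun u => (ω₁ u).1) f₁ u else 0,
    fun x m => ∑ u, if (ω₂ u).2 = m then encU (k₂ x) (fun u => (ω₂ u).1) f₂ u else 0,
    fun m₁ m₂ => swDec T ω₁ ω₂ (f₁, m₁) (f₂, m₂), ?_, ?_, ?_, ?_, ?_⟩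
  · intro x m
    refine Finset.sum_nonneg fun u _ => ?_
    split_ifs
    · exact encU_nonneg _ (hk₁ x) _ _ _
    · exact le_rfl
  · intro x
    exact (binMass_sum (encU (k₁ x) (fun u => (ω₁ u).1) f₁) (fun u => (ω₁ u).2)).trans
      (encU_sum _ _ _)
  · intro x m
    refine Finset.sum_nonneg fun u _ => ?_
    split_ifs
    · exact encU_nonneg _ (hk₂ x) _ _ _
    · exact le_rfl
  · intro x
    exact (binMass_sum (encU (k₂ x) (fun u => (ω₂ u).1) f₂) (fun u => (ω₂ u).2)).trans
      (encU_sum _ _ _)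
  · refine le_trans (le_of_eq ?_) h4
    simp only [hR]
    refine Finset.sum_congr rfl fun x _ => ?_
    congr 1
    have sw : ∀ G : M₁ → M₂ → U₁ → U₂ → ℝ, ∑ f₁, ∑ f₂, ∑ u₁, ∑ u₂, G f₁ f₂ u₁ u₂ =
        ∑ u₁, ∑ u₂, ∑ f₁, ∑ f₂, G f₁ f₂ u₁ u₂ := by
      intro G
      calc _ = ∑ f₁, ∑ u₁, ∑ f₂, ∑ u₂, G f₁ f₂ u₁ u₂ :=
            Finset.sum_congr rfl fun _ _ => Finset.sum_comm
        _ = ∑ u₁, ∑ f₁, ∑ f₂, ∑ u₂, G f₁ f₂ u₁ u₂ := Finset.sum_comm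
        _ = ∑ u₁, ∑ f₁, ∑ u₂, ∑ f₂, G f₁ f₂ u₁ u₂ :=
            Finset.sum_congr rfl fun _ _ => Finset.sum_congr rfl fun _ _ => Finset.sum_comm
        _ = _ := Finset.sum_congr rfl fun _ _ => Finset.sum_comm
    simp only [Finset.sum_mul_sum]
    simp only [Finset.sum_mul]
    rw [sw]
    refine Finset.sum_congr rfl fun u₁ _ => Finset.sum_congr rfl fun u₂ _ => ?_
    simp only [ite_mul, mul_ite, zero_mul, mul_zero, Finset.sum_ite_eq, Finset.mem_univ, if_true,
      hh]

/-- With a single bin there is no deviation from uniformity. -/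
lemma hash_single {U F M : Type} [Fintype U] [Fintype F] [Fintype M]
    (w : U → ℝ) (hw1 : ∑ u, w u = 1) (hF : Fintype.card F = 1) :
    Ew (fun ω : U → F × M =>
      ∑ f, |(Fintype.card F : ℝ)⁻¹ - ∑ u, if (ω u).1 = f then w u else 0|) = 0 := by
  have hs : Subsingleton F := Fintype.card_le_one_iff_subsingleton.1 hF.le
  have : ∀ (ω : U → F × M) (f : F), (∑ u, if (ω u).1 = f then w u else 0) = 1 := by
    intro ω f
    rw [← hw1]
    exact Finset.sum_congr rfl fun u _ => if_pos (Subsingleton.elim _ _)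
  simp [this, hF, Ew]

/-! ### Part C: i.i.d. sums -/

section iid
variable {A : Type} [Fintype A]

lemma iid_sum_prod {n : ℕ} (G : Fin n → A → ℝ) :
    ∑ a : Fin n → A, ∏ i, G i (a i) = ∏ i, ∑ k, G i k := by
  rw [Finset.prod_univ_sum]; simp

lemma iid_total {n : ℕ} (J : A → ℝ) (hJ1 : ∑ a, J a = 1) :
    ∑ a : Fin n → A, ∏ i, J (a i) = 1 := by
  rw [iid_sum_prod (fun _ => J)]; simp [hJ1]

lemma sum_fin_succ {n : ℕ} (G : (Fin (n + 1) → A) → ℝ) :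
    ∑ a, G a = ∑ a₀ : A, ∑ a : Fin n → A, G (Fin.cons a₀ a) := by
  rw [← (Fin.consEquiv (fun _ : Fin (n + 1) => A)).sum_comp, Fintype.sum_prod_type]
  rfl

lemma iid_first (J c : A → ℝ) (hJ1 : ∑ a, J a = 1) (hc : ∑ a, J a * c a = 0) (n : ℕ) :
    ∑ a : Fin n → A, (∏ i, J (a i)) * (∑ i, c (a i)) = 0 := by
  induction n with
  | zero => simp
  | succ n ih =>
    rw [sum_fin_succ]
    simp only [Fin.prod_univ_succ, Fin.sum_univ_succ, Fin.cons_zero, Fin.cons_succ]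
    have : ∀ a₀ : A, ∑ a : Fin n → A, J a₀ * (∏ i, J (a i)) * (c a₀ + ∑ i, c (a i)) =
        J a₀ * c a₀ := by
      intro a₀
      have : ∀ a : Fin n → A, J a₀ * (∏ i, J (a i)) * (c a₀ + ∑ i, c (a i)) =
          (J a₀ * c a₀) * (∏ i, J (a i)) + J a₀ * ((∏ i, J (a i)) * (∑ i, c (a i))) := by
        intro a; ring
      simp only [this, Finset.sum_add_distrib, ← Finset.mul_sum, ih, iid_total J hJ1]
      ring
    simp only [this, hc]

lemma iid_second (J c : A → ℝ) (hJ1 : ∑ a, J a = 1) (hc : ∑ a, J a * c a = 0) (n : ℕ) :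
    ∑ a : Fin n → A, (∏ i, J (a i)) * (∑ i, c (a i)) ^ 2 = n * ∑ a, J a * c a ^ 2 := by
  induction n with
  | zero => simp
  | succ n ih =>
    rw [sum_fin_succ]
    simp only [Fin.prod_univ_succ, Fin.sum_univ_succ, Fin.cons_zero, Fin.cons_succ]
    have : ∀ a₀ : A, ∑ a : Fin n → A, J a₀ * (∏ i, J (a i)) * (c a₀ + ∑ i, c (a i)) ^ 2 =
        J a₀ * c a₀ ^ 2 + J a₀ * (n * ∑ a, J a * c a ^ 2) := by
      intro a₀
      have : ∀ a : Fin n → A, J a₀ * (∏ i, J (a i)) * (c a₀ + ∑ i, c (a i)) ^ 2 =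
          (J a₀ * c a₀ ^ 2) * (∏ i, J (a i)) +
          (2 * J a₀ * c a₀) * ((∏ i, J (a i)) * (∑ i, c (a i))) +
          J a₀ * ((∏ i, J (a i)) * (∑ i, c (a i)) ^ 2) := by
        intro a; ring
      simp only [this, Finset.sum_add_distrib, ← Finset.mul_sum, ih, iid_total J hJ1,
        iid_first J c hJ1 hc]
      ring
    simp only [this, Finset.sum_add_distrib, ← Finset.sum_mul, hJ1]
    push_cast; ring

/-- Variance of `f` under `J`. -/
def varJ (J f : A → ℝ) : ℝ := ∑ a, J a * (f a - ∑ b, J b * f b) ^ 2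

lemma cheb (J : A → ℝ) (hJ : ∀ a, 0 ≤ J a) (hJ1 : ∑ a, J a = 1) (f : A → ℝ) {δ : ℝ} (hδ : 0 < δ)
    {n : ℕ} (hn : 0 < n) (E : (Fin n → A) → Prop)
    (hE : ∀ a, (∀ i, 0 < J (a i)) → E a → n * ((∑ b, J b * f b) + δ) ≤ ∑ i, f (a i)) :
    ∑ a : Fin n → A, (∏ i, J (a i)) * ind (E a) ≤ varJ J f / (n * δ ^ 2) := by
  have hn' : (0 : ℝ) < n := by exact_mod_cast hn
  set μ := ∑ b, J b * f b with hμ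
  set c : A → ℝ := fun a => f a - μ with hc
  have hc0 : ∑ a, J a * c a = 0 := by
    simp only [hc, mul_sub, Finset.sum_sub_distrib, ← Finset.sum_mul, hJ1, ← hμ]; ring
  have h2 := iid_second J c hJ1 hc0 n
  have hpt : ∀ a : Fin n → A, (∏ i, J (a i)) * ind (E a) ≤
      ((n : ℝ) * δ)⁻¹ ^ 2 * ((∏ i, J (a i)) * (∑ i, c (a i)) ^ 2) := by
    intro a
    have hP : 0 ≤ ∏ i, J (a i) := Finset.prod_nonneg fun i _ => hJ _
    by_cases hpos : ∀ i, 0 < J (a i)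
    · by_cases hEa : E a
      · have h3 := hE a hpos hEa
        have h4 : (n : ℝ) * δ ≤ ∑ i, c (a i) := by
          simp only [hc, Finset.sum_sub_distrib]
          simp; linarith
        rw [ind_true hEa]
        have h5 : 1 ≤ ((n : ℝ) * δ)⁻¹ ^ 2 * (∑ i, c (a i)) ^ 2 := by
          rw [← mul_pow]
          apply one_le_pow₀
          rw [inv_mul_eq_div, one_le_div (by positivity)]
          exact h4
        nlinarith
      · rw [ind_false hEa]; simp only [mul_zero]; positivity
    · push Not at hpos
      obtain ⟨i, hi⟩ := hpos
      have : ∏ i, J (a i) = 0 := Finset.prod_eq_zero (Finset.mem_univ i) (le_antisymm hi (hJ _))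
      simp [this]
  refine (Finset.sum_le_sum fun a _ => hpt a).trans (le_of_eq ?_)
  rw [← Finset.mul_sum, h2]
  simp only [varJ, hc, ← hμ]
  field_simp

end iid

lemma prod_lt_log {n : ℕ} (q r : Fin n → ℝ) (hq : ∀ i, 0 < q i) (hr : ∀ i, 0 < r i) (t : ℝ)
    (h : (2 : ℝ) ^ t * ∏ i, r i < ∏ i, q i) :
    t ≤ ∑ i, (Real.logb 2 (q i) - Real.logb 2 (r i)) := by
  have hR : 0 < ∏ i, r i := Finset.prod_pos fun i _ => hr i
  have h2 : (0 : ℝ) < 2 ^ t := by positivity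
  have h1 := Real.logb_le_logb_of_le (b := 2) (by norm_num) (by positivity) h.le
  rw [Real.logb_mul h2.ne' hR.ne', Real.logb_rpow (by norm_num) (by norm_num),
    Real.logb_prod _ _ (fun i _ => (hr i).ne'), Real.logb_prod _ _ (fun i _ => (hq i).ne')] at h1
  rw [Finset.sum_sub_distrib]
  linarith

lemma count_le {U : Type} [Fintype U] (q : U → ℝ) (hq : ∀ u, 0 ≤ q u) (s : ℝ) (hs : ∑ u, q u = s)
    (T : U → Prop) (L : ℝ) (hL : 0 ≤ L) (hT : ∀ u, T u → 0 < q u ∧ s ≤ L * q u) :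
    ∑ u, ind (T u) ≤ L := by
  by_cases hs0 : 0 < s
  · calc ∑ u, ind (T u) ≤ ∑ u, L / s * q u := by
          refine Finset.sum_le_sum fun u _ => ?_
          by_cases h : T u
          · rw [ind_true h, div_mul_eq_mul_div, one_le_div hs0]
            exact (hT u h).2
          · rw [ind_false h]
            exact mul_nonneg (div_nonneg hL hs0.le) (hq u)
      _ = L := by rw [← Finset.mul_sum, hs]; field_simp
  · have : ∀ u, ¬ T u := by
      intro u h
      have h1 := (hT u h).1
      have h2 := Finset.single_le_sum (f := q) (fun u _ => hq u) (Finset.mem_univ u)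
      linarith
    simp [ind_false (this _), hL]

/-! ### Part D: entropy identities -/

section entropy
variable {α β γ : Type} [Fintype α] [Fintype β] [Fintype γ]

lemma pmap_eq (f : α → β) (p : α → ℝ) (b : β) :
    pmap f p b = ∑ a, if f a = b then p a else 0 := tsum_fintype _

lemma pmap_sum (f : α → β) (p : α → ℝ) (g : β → ℝ) :
    ∑ b, pmap f p b * g b = ∑ a, p a * g (f a) := by
  simp only [pmap_eq, Finset.sum_mul, ite_mul, zero_mul]
  rw [Finset.sum_comm]
  simp

lemma pmap_pmap (f : α → β) (g : β → γ) (p : α → ℝ) :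
    pmap g (pmap f p) = pmap (fun a => g (f a)) p := by
  funext c
  rw [pmap_eq, pmap_eq]
  have := pmap_sum f p (fun b => if g b = c then 1 else 0)
  simpa using this

lemma H2_pmap (f : α → β) (p : α → ℝ) :
    H2 (pmap f p) = ∑ a, p a * -(Real.logb 2 (pmap f p (f a))) := by
  rw [← pmap_sum f p (fun b => -(Real.logb 2 (pmap f p b)))]
  unfold H2
  rw [tsum_fintype]
  exact Finset.sum_congr rfl fun b _ => by ring

lemma pmap_pos (f : α → β) (p : α → ℝ) (hp : ∀ a, 0 ≤ p a) (a : α) (ha : 0 < p a) :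
    0 < pmap f p (f a) := by
  rw [pmap_eq]
  have := Finset.single_le_sum (f := fun c => if f c = f a then p c else 0)
    (fun c _ => by split_ifs <;> simp [hp]) (Finset.mem_univ a)
  simp only [if_true] at this
  linarith

lemma pmap_nonneg (f : α → β) (p : α → ℝ) (hp : ∀ a, 0 ≤ p a) (b : β) : 0 ≤ pmap f p b := by
  rw [pmap_eq]
  exact Finset.sum_nonneg fun c _ => by split_ifs <;> simp [hp]

end entropy

/-- The single-letter joint law. -/
def Jd {X₁ X₂ U₁ U₂ : Type} (pS : X₁ × X₂ → ℝ) (k₁ : X₁ → U₁ → ℝ) (k₂ : X₂ → U₂ → ℝ) :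
    X₁ × X₂ × U₁ × U₂ → ℝ :=
  fun a => pS (a.1, a.2.1) * k₁ a.1 a.2.2.1 * k₂ a.2.1 a.2.2.2

section joint
variable {X₁ X₂ U₁ U₂ : Type} [Fintype X₁] [Fintype X₂] [Fintype U₁] [Fintype U₂]
  (pS : X₁ × X₂ → ℝ) (k₁ : X₁ → U₁ → ℝ) (k₂ : X₂ → U₂ → ℝ)

/-- Law of `(U₁, U₂)`. -/
def q12 : U₁ × U₂ → ℝ := pmap (fun a : X₁ × X₂ × U₁ × U₂ => (a.2.2.1, a.2.2.2)) (Jd pS k₁ k₂)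
/-- Law of `U₁`. -/
def q1 : U₁ → ℝ := pmap (fun a : X₁ × X₂ × U₁ × U₂ => a.2.2.1) (Jd pS k₁ k₂)
/-- Law of `U₂`. -/
def q2 : U₂ → ℝ := pmap (fun a : X₁ × X₂ × U₁ × U₂ => a.2.2.2) (Jd pS k₁ k₂)

lemma q12_sum_left (u₂ : U₂) : ∑ u₁, q12 pS k₁ k₂ (u₁, u₂) = q2 pS k₁ k₂ u₂ := by
  unfold q12 q2
  simp only [pmap_eq]
  rw [Finset.sum_comm]
  refine Finset.sum_congr rfl fun a _ => ?_
  simp only [Prod.mk.injEq, ite_and]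
  simp

lemma q12_sum_right (u₁ : U₁) : ∑ u₂, q12 pS k₁ k₂ (u₁, u₂) = q1 pS k₁ k₂ u₁ := by
  unfold q12 q1
  simp only [pmap_eq]
  rw [Finset.sum_comm]
  refine Finset.sum_congr rfl fun a _ => ?_
  simp only [Prod.mk.injEq]
  by_cases h : a.2.2.1 = u₁ <;> simp [h]

lemma Jd_sum (hp : ∑ x, pS x = 1) (h1 : ∀ x, ∑ u, k₁ x u = 1) (h2 : ∀ x, ∑ u, k₂ x u = 1) :
    ∑ a, Jd pS k₁ k₂ a = 1 := by
  simp only [Jd, Fintype.sum_prod_type, ← Finset.mul_sum, h2, mul_one, h1]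
  rw [← hp, Fintype.sum_prod_type]

lemma q12_sum (hp : ∑ x, pS x = 1) (h1 : ∀ x, ∑ u, k₁ x u = 1) (h2 : ∀ x, ∑ u, k₂ x u = 1) :
    ∑ u, q12 pS k₁ k₂ u = 1 := by
  have := pmap_sum (fun a : X₁ × X₂ × U₁ × U₂ => (a.2.2.1, a.2.2.2)) (Jd pS k₁ k₂) (fun _ => 1)
  simp only [mul_one, Jd_sum pS k₁ k₂ hp h1 h2] at this
  exact this

lemma marg1 (h1 : ∀ x, ∑ u, k₁ x u = 1) (x : X₁) (u : U₁) (v : U₂) :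
    pmap (fun a : X₁ × X₂ × U₁ × U₂ => (a.1, a.2.2.1, a.2.2.2)) (Jd pS k₁ k₂) (x, u, v) =
    pmap (fun a : X₁ × X₂ × U₁ × U₂ => (a.1, a.2.2.2)) (Jd pS k₁ k₂) (x, v) * k₁ x u := by
  simp only [pmap_eq, Jd, Fintype.sum_prod_type, Prod.mk.injEq, ite_and]
  rw [Finset.sum_eq_single x, Finset.sum_eq_single x]
  · simp only [if_true, Finset.sum_ite_eq', Finset.mem_univ]
    rw [Finset.sum_mul]
    refine Finset.sum_congr rfl fun y _ => ?_
    rw [Finset.sum_eq_single u]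
    · simp only [if_true, Finset.sum_ite_eq', Finset.mem_univ]
      rw [← Finset.sum_mul, ← Finset.mul_sum, h1]; ring
    · intro b _ hb; simp [hb]
    · simp
  · intro b _ hb; simp [hb]
  · simp
  · intro b _ hb; simp [hb]
  · simp

lemma marg2 (h2 : ∀ x, ∑ u, k₂ x u = 1) (x : X₂) (u : U₁) (v : U₂) :
    pmap (fun a : X₁ × X₂ × U₁ × U₂ => (a.2.1, a.2.2.2, a.2.2.1)) (Jd pS k₁ k₂) (x, v, u) =
    pmap (fun a : X₁ × X₂ × U₁ × U₂ => (a.2.1, a.2.2.1)) (Jd pS k₁ k₂) (x, u) * k₂ x v := by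
  simp only [pmap_eq, Jd, Fintype.sum_prod_type, Prod.mk.injEq, ite_and]
  rw [Finset.sum_mul]
  refine Finset.sum_congr rfl fun y _ => ?_
  rw [Finset.sum_eq_single x, Finset.sum_eq_single x]
  · simp only [if_true]
    rw [Finset.sum_eq_single u, Finset.sum_eq_single u]
    · simp only [if_true, Finset.sum_ite_eq', Finset.mem_univ]
      rw [← Finset.mul_sum, h2]; ring
    · intro b _ hb; simp [hb]
    · simp
    · intro b _ hb; simp [hb]
    · simp
  · intro b _ hb; simp [hb]
  · simp
  · intro b _ hb; simp [hb]
  · simp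

lemma marg12 (h1 : ∀ x, ∑ u, k₁ x u = 1) (h2 : ∀ x, ∑ u, k₂ x u = 1) (x : X₁ × X₂) :
    pmap (fun a : X₁ × X₂ × U₁ × U₂ => (a.1, a.2.1)) (Jd pS k₁ k₂) x = pS x := by
  obtain ⟨x, y⟩ := x
  simp only [pmap_eq, Jd, Fintype.sum_prod_type, Prod.mk.injEq, ite_and]
  rw [Finset.sum_eq_single x, Finset.sum_eq_single y]
  · simp only [if_true, ← Finset.mul_sum, h2, h1, mul_one]
  · intro b _ hb; simp [hb]
  · simp
  · intro b _ hb; simp [hb]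
  · simp

lemma pmap_inj {α β : Type} [Fintype α] [Fintype β] (f : α → β) (hf : Function.Injective f)
    (p : α → ℝ) (a : α) : pmap f p (f a) = p a := by
  rw [pmap_eq]
  simp [hf.eq_iff]

lemma pmap_swap (u : U₁) (v : U₂) :
    pmap (fun a : X₁ × X₂ × U₁ × U₂ => (a.2.2.2, a.2.2.1)) (Jd pS k₁ k₂) (v, u) =
      q12 pS k₁ k₂ (u, v) := by
  unfold q12
  simp only [pmap_eq, Prod.mk.injEq]
  simp only [and_comm]

/-- Mean of `f` under the joint law. -/
def mu (f : X₁ × X₂ × U₁ × U₂ → ℝ) : ℝ := ∑ a, Jd pS k₁ k₂ a * f a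

/-- `log` ratios. -/
def f₁ (a : X₁ × X₂ × U₁ × U₂) : ℝ :=
  Real.logb 2 (q2 pS k₁ k₂ a.2.2.2) - Real.logb 2 (q12 pS k₁ k₂ (a.2.2.1, a.2.2.2))
/-- `log` ratios. -/
def f₂ (a : X₁ × X₂ × U₁ × U₂) : ℝ :=
  Real.logb 2 (q1 pS k₁ k₂ a.2.2.1) - Real.logb 2 (q12 pS k₁ k₂ (a.2.2.1, a.2.2.2))
/-- `log` ratios. -/
def f₁₂ (a : X₁ × X₂ × U₁ × U₂) : ℝ :=
  Real.logb 2 1 - Real.logb 2 (q12 pS k₁ k₂ (a.2.2.1, a.2.2.2))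
/-- `log` ratios. -/
def f₃ (a : X₁ × X₂ × U₁ × U₂) : ℝ :=
  Real.logb 2 (k₁ a.1 a.2.2.1) - Real.logb 2 1
/-- `log` ratios. -/
def f₄ (a : X₁ × X₂ × U₁ × U₂) : ℝ :=
  Real.logb 2 (k₂ a.2.1 a.2.2.2) - Real.logb 2 1


lemma Jd_nonneg (hp : ∀ x, 0 ≤ pS x) (hk₁ : ∀ x u, 0 ≤ k₁ x u) (hk₂ : ∀ x u, 0 ≤ k₂ x u)
    (a : X₁ × X₂ × U₁ × U₂) : 0 ≤ Jd pS k₁ k₂ a :=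
  mul_nonneg (mul_nonneg (hp _) (hk₁ _ _)) (hk₂ _ _)

lemma Jd_pos (hp : ∀ x, 0 ≤ pS x) (hk₁ : ∀ x u, 0 ≤ k₁ x u) (hk₂ : ∀ x u, 0 ≤ k₂ x u)
    {a : X₁ × X₂ × U₁ × U₂} (h : 0 < Jd pS k₁ k₂ a) :
    0 < pS (a.1, a.2.1) ∧ 0 < k₁ a.1 a.2.2.1 ∧ 0 < k₂ a.2.1 a.2.2.2 := by
  unfold Jd at h
  refine ⟨lt_of_le_of_ne (hp _) ?_, lt_of_le_of_ne (hk₁ _ _) ?_, lt_of_le_of_ne (hk₂ _ _) ?_⟩ <;>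
  · intro h0
    rw [← h0] at h
    simp at h

lemma cmi1 (hp : ∀ x, 0 ≤ pS x) (hk₁ : ∀ x u, 0 ≤ k₁ x u) (hk₂ : ∀ x u, 0 ≤ k₂ x u)
    (h1 : ∀ x, ∑ u, k₁ x u = 1) :
    CMI (pmap (fun a : X₁ × X₂ × U₁ × U₂ => (a.1, a.2.2.1, a.2.2.2)) (Jd pS k₁ k₂)) =
      mu pS k₁ k₂ (f₁ pS k₁ k₂) + mu pS k₁ k₂ (f₃ k₁) := by
  have hJ := Jd_nonneg pS k₁ k₂ hp hk₁ hk₂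
  unfold CMI mu
  simp only [pmap_pmap]
  simp only [H2_pmap]
  rw [← Finset.sum_add_distrib, ← Finset.sum_add_distrib, ← Finset.sum_sub_distrib,
    ← Finset.sum_sub_distrib]
  refine Finset.sum_congr rfl fun a _ => ?_
  rcases (hJ a).eq_or_lt with h0 | h0
  · rw [← h0]; ring
  · rw [marg1 pS k₁ k₂ h1, Real.logb_mul
      (pmap_pos (fun a : X₁ × X₂ × U₁ × U₂ => (a.1, a.2.2.2)) _ hJ a h0).ne'
      (Jd_pos pS k₁ k₂ hp hk₁ hk₂ h0).2.1.ne']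
    simp only [f₁, f₃, q2, q12, Real.logb_one]
    ring

lemma cmi2 (hp : ∀ x, 0 ≤ pS x) (hk₁ : ∀ x u, 0 ≤ k₁ x u) (hk₂ : ∀ x u, 0 ≤ k₂ x u)
    (h2 : ∀ x, ∑ u, k₂ x u = 1) :
    CMI (pmap (fun a : X₁ × X₂ × U₁ × U₂ => (a.2.1, a.2.2.2, a.2.2.1)) (Jd pS k₁ k₂)) =
      mu pS k₁ k₂ (f₂ pS k₁ k₂) + mu pS k₁ k₂ (f₄ k₂) := by
  have hJ := Jd_nonneg pS k₁ k₂ hp hk₁ hk₂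
  unfold CMI mu
  simp only [pmap_pmap]
  simp only [H2_pmap]
  rw [← Finset.sum_add_distrib, ← Finset.sum_add_distrib, ← Finset.sum_sub_distrib,
    ← Finset.sum_sub_distrib]
  refine Finset.sum_congr rfl fun a _ => ?_
  rcases (hJ a).eq_or_lt with h0 | h0
  · rw [← h0]; ring
  · rw [marg2 pS k₁ k₂ h2, Real.logb_mul
      (pmap_pos (fun a : X₁ × X₂ × U₁ × U₂ => (a.2.1, a.2.2.1)) _ hJ a h0).ne'
      (Jd_pos pS k₁ k₂ hp hk₁ hk₂ h0).2.2.ne', pmap_swap]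
    simp only [f₂, f₄, q1, Real.logb_one]
    ring

lemma mi12 (hp : ∀ x, 0 ≤ pS x) (hk₁ : ∀ x u, 0 ≤ k₁ x u) (hk₂ : ∀ x u, 0 ≤ k₂ x u)
    (h1 : ∀ x, ∑ u, k₁ x u = 1) (h2 : ∀ x, ∑ u, k₂ x u = 1) :
    MI (pmap (fun a : X₁ × X₂ × U₁ × U₂ => ((a.1, a.2.1), (a.2.2.1, a.2.2.2))) (Jd pS k₁ k₂)) =
      mu pS k₁ k₂ (f₁₂ pS k₁ k₂) + mu pS k₁ k₂ (f₃ k₁) + mu pS k₁ k₂ (f₄ k₂) := by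
  have hJ := Jd_nonneg pS k₁ k₂ hp hk₁ hk₂
  have hinj : Function.Injective
      (fun a : X₁ × X₂ × U₁ × U₂ => ((a.1, a.2.1), (a.2.2.1, a.2.2.2))) := by
    rintro ⟨a, b, c, d⟩ ⟨a', b', c', d'⟩ h
    simp only [Prod.mk.injEq] at h ⊢
    tauto
  unfold MI mu
  simp only [pmap_pmap]
  simp only [H2_pmap]
  rw [← Finset.sum_add_distrib, ← Finset.sum_add_distrib, ← Finset.sum_sub_distrib,
    ← Finset.sum_add_distrib]
  refine Finset.sum_congr rfl fun a _ => ?_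
  rcases (hJ a).eq_or_lt with h0 | h0
  · rw [← h0]; ring
  · have hpos := Jd_pos pS k₁ k₂ hp hk₁ hk₂ h0
    rw [pmap_inj _ hinj, marg12 pS k₁ k₂ h1 h2]
    have : Real.logb 2 (Jd pS k₁ k₂ a) = Real.logb 2 (pS (a.1, a.2.1)) +
        Real.logb 2 (k₁ a.1 a.2.2.1) + Real.logb 2 (k₂ a.2.1 a.2.2.2) := by
      unfold Jd
      rw [Real.logb_mul (mul_pos hpos.1 hpos.2.1).ne' hpos.2.2.ne',
        Real.logb_mul hpos.1.ne' hpos.2.1.ne']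
    rw [this]
    simp only [f₁₂, f₃, f₄, q12, Real.logb_one]
    ring

end joint

/-! ### Part E: block coding -/

lemma nMsg_lb (n : ℕ) (r : ℝ) : (2 : ℝ) ^ ((n : ℝ) * r) ≤ nMsg n r := Nat.le_ceil _

lemma nMsg_pos (n : ℕ) (r : ℝ) : 0 < nMsg n r := Nat.ceil_pos.2 (by positivity)

lemma nMsg_one (n : ℕ) (r : ℝ) (hr : r ≤ 0) : nMsg n r = 1 := by
  apply le_antisymm _ (nMsg_pos n r)
  apply Nat.ceil_le.2
  have : (2 : ℝ) ^ ((n : ℝ) * r) ≤ 1 :=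
    Real.rpow_le_one_of_one_le_of_nonpos (by norm_num)
      (mul_nonpos_of_nonneg_of_nonpos (by positivity) hr)
  simpa using this

lemma nMsg_ub (n : ℕ) (r : ℝ) (hr : 0 ≤ r) : (nMsg n r : ℝ) ≤ 2 * (2 : ℝ) ^ ((n : ℝ) * r) := by
  have h1 : (1 : ℝ) ≤ (2 : ℝ) ^ ((n : ℝ) * r) := Real.one_le_rpow (by norm_num) (by positivity)
  have := (Nat.ceil_lt_add_one (a := (2 : ℝ) ^ ((n : ℝ) * r)) (by positivity)).le
  unfold nMsg
  linarith

lemma theta_bound {X U M F : Type} [Fintype X] [Fintype U] [Fintype M] [Nonempty U] [Nonempty M]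
    [Fintype F] [Nonempty F]
    (p : X → ℝ) (hp : ∀ x, 0 ≤ p x) (hp1 : ∑ x, p x = 1) (κ : X → U → ℝ) (hκ : ∀ x u, 0 ≤ κ x u)
    (hκ1 : ∀ x, ∑ u, κ x u = 1) (n : ℕ) (μ δ η v : ℝ) (hη : 0 < η)
    (hF : Fintype.card F = nMsg n (-μ - 2 * δ))
    (hv : ∑ x, p x * (∑ u, if (2 : ℝ) ^ ((n : ℝ) * (μ + δ)) < κ x u then κ x u else 0) ≤ v) :
    ∑ x, p x * Ew (fun ω : U → F × M =>
      ∑ f, |(Fintype.card F : ℝ)⁻¹ - ∑ u, if (ω u).1 = f then κ x u else 0|) ≤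
      2 * v + (η + 2 * (2 : ℝ) ^ (-((n : ℝ) * δ)) * η⁻¹) := by
  have hv0 : 0 ≤ v := by
    refine le_trans (Finset.sum_nonneg fun x _ => mul_nonneg (hp x)
      (Finset.sum_nonneg fun u _ => ?_)) hv
    split_ifs
    · exact hκ x u
    · exact le_rfl
  by_cases hr : -μ - 2 * δ ≤ 0
  · have h1 : Fintype.card F = 1 := hF.trans (nMsg_one n _ hr)
    have h0 : ∀ x, p x * Ew (fun ω : U → F × M =>
      ∑ f, |(Fintype.card F : ℝ)⁻¹ - ∑ u, if (ω u).1 = f then κ x u else 0|) = 0 := fun x => by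
        rw [hash_single (κ x) (hκ1 x) h1, mul_zero]
    rw [Finset.sum_congr rfl fun x _ => h0 x, Finset.sum_const_zero]
    positivity
  · have hb := fun x => hash_unif (F := F) (M := M) (κ x) (hκ x) (hκ1 x)
      ((2 : ℝ) ^ ((n : ℝ) * (μ + δ))) η (by positivity) hη
    refine (Finset.sum_le_sum fun x _ => mul_le_mul_of_nonneg_left (hb x) (hp x)).trans ?_
    simp only [mul_add, Finset.sum_add_distrib]
    rw [← Finset.sum_mul, ← Finset.sum_mul, hp1, one_mul, one_mul]
    apply add_le_add
    · calc _ = 2 * ∑ x, p x *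
            (∑ u, if (2 : ℝ) ^ ((n : ℝ) * (μ + δ)) < κ x u then κ x u else 0) := by
            rw [Finset.mul_sum]
            refine Finset.sum_congr rfl fun x _ => ?_
            rw [mul_add]; ring
        _ ≤ _ := by linarith
    · have h2 := nMsg_ub n (-μ - 2 * δ) (le_of_lt (not_le.1 hr))
      have h3 : (Fintype.card F : ℝ) * (2 : ℝ) ^ ((n : ℝ) * μ + n * δ) ≤
          2 * (2 : ℝ) ^ (-((n : ℝ) * δ)) := by
        rw [hF]
        calc _ ≤ 2 * (2 : ℝ) ^ ((n : ℝ) * (-μ - 2 * δ)) * (2 : ℝ) ^ ((n : ℝ) * μ + n * δ) :=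
              mul_le_mul_of_nonneg_right h2 (by positivity)
          _ = _ := by
              rw [mul_assoc, ← Real.rpow_add (by norm_num)]
              congr 2; ring
      exact add_le_add le_rfl (mul_le_mul_of_nonneg_right h3 (by positivity))

section block
variable {X₁ X₂ U₁ U₂ : Type} [Fintype X₁] [Fintype X₂] [Fintype U₁] [Fintype U₂]
  (pS : X₁ × X₂ → ℝ) (k₁ : X₁ → U₁ → ℝ) (k₂ : X₂ → U₂ → ℝ)

/-- Interleaving of blocks. -/
def blockEquiv (X₁ X₂ U₁ U₂ : Type) (n : ℕ) : (Fin n → X₁ × X₂ × U₁ × U₂) ≃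
    ((Fin n → X₁) × (Fin n → X₂)) × (Fin n → U₁) × (Fin n → U₂) where
  toFun a := ((fun i => (a i).1, fun i => (a i).2.1), (fun i => (a i).2.2.1, fun i => (a i).2.2.2))
  invFun b := fun i => (b.1.1 i, b.1.2 i, b.2.1 i, b.2.2 i)
  left_inv _ := rfl
  right_inv _ := rfl

lemma block_sum {n : ℕ}
    (G : (Fin n → X₁) × (Fin n → X₂) → (Fin n → U₁) → (Fin n → U₂) → ℝ) :
    ∑ x : (Fin n → X₁) × (Fin n → X₂), (∏ i, pS (x.1 i, x.2 i)) *
      ∑ u₁ : Fin n → U₁, ∑ u₂ : Fin n → U₂,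
        (∏ i, k₁ (x.1 i) (u₁ i)) * (∏ i, k₂ (x.2 i) (u₂ i)) * G x u₁ u₂ =
    ∑ a : Fin n → X₁ × X₂ × U₁ × U₂, (∏ i, Jd pS k₁ k₂ (a i)) *
      G (fun i => (a i).1, fun i => (a i).2.1) (fun i => (a i).2.2.1) (fun i => (a i).2.2.2) := by
  rw [← Equiv.sum_comp (blockEquiv X₁ X₂ U₁ U₂ n).symm (fun a => (∏ i, Jd pS k₁ k₂ (a i)) *
      G (fun i => (a i).1, fun i => (a i).2.1) (fun i => (a i).2.2.1) (fun i => (a i).2.2.2))]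
  simp only [Fintype.sum_prod_type, Finset.mul_sum]
  refine Finset.sum_congr rfl fun x₁ _ => Finset.sum_congr rfl fun x₂ _ =>
    Finset.sum_congr rfl fun u₁ _ => Finset.sum_congr rfl fun u₂ _ => ?_
  simp only [blockEquiv, Equiv.coe_fn_symm_mk, Jd, Finset.prod_mul_distrib]
  ring

lemma ind_or (a b : Prop) : ind (a ∨ b) ≤ ind a + ind b := by
  by_cases ha : a
  · rw [ind_true ha]; linarith [ind_le_one (a ∨ b), ind_nonneg b]
  · simp [ha, ind_false]

set_option maxHeartbeats 4000000 in
/-- Block version of the achievability bound. -/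
theorem nfold [Nonempty U₁] [Nonempty U₂]
    (hp : ∀ x, 0 ≤ pS x) (hp1 : ∑ x, pS x = 1)
    (hk₁ : ∀ x u, 0 ≤ k₁ x u) (hk₂ : ∀ x u, 0 ≤ k₂ x u)
    (hs₁ : ∀ x, ∑ u, k₁ x u = 1) (hs₂ : ∀ x, ∑ u, k₂ x u = 1)
    (R₁ R₂ δ η : ℝ) (hδ : 0 < δ) (hη : 0 < η)
    (hR₁ : mu pS k₁ k₂ (f₁ pS k₁ k₂) + mu pS k₁ k₂ (f₃ k₁) + 4 * δ ≤ R₁)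
    (hR₂ : mu pS k₁ k₂ (f₂ pS k₁ k₂) + mu pS k₁ k₂ (f₄ k₂) + 4 * δ ≤ R₂)
    (hR : mu pS k₁ k₂ (f₁₂ pS k₁ k₂) + mu pS k₁ k₂ (f₃ k₁) + mu pS k₁ k₂ (f₄ k₂) + 6 * δ ≤ R₁ + R₂)
    (f₅ f₆ : X₁ × X₂ × U₁ × U₂ → ℝ) (n : ℕ) (hn : 0 < n) :
    ∃ (e₁ : (Fin n → X₁) → Fin (nMsg n R₁) → ℝ) (e₂ : (Fin n → X₂) → Fin (nMsg n R₂) → ℝ)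
      (dec : Fin (nMsg n R₁) → Fin (nMsg n R₂) → (Fin n → U₁) × (Fin n → U₂)),
      (∀ x m, 0 ≤ e₁ x m) ∧ (∀ x, ∑ m, e₁ x m = 1) ∧
      (∀ x m, 0 ≤ e₂ x m) ∧ (∀ x, ∑ m, e₂ x m = 1) ∧
      ∑ x : (Fin n → X₁) × (Fin n → X₂), (∏ i, pS (x.1 i, x.2 i)) *
        ∑ m₁, ∑ m₂, e₁ x.1 m₁ * e₂ x.2 m₂ *
        ind (n * (mu pS k₁ k₂ f₅ + δ) <
            ∑ i, f₅ (x.1 i, x.2 i, (dec m₁ m₂).1 i, (dec m₁ m₂).2 i) ∨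
          n * (mu pS k₁ k₂ f₆ + δ) <
            ∑ i, f₆ (x.1 i, x.2 i, (dec m₁ m₂).1 i, (dec m₁ m₂).2 i)) ≤
      (varJ (Jd pS k₁ k₂) f₅ + varJ (Jd pS k₁ k₂) f₆ + varJ (Jd pS k₁ k₂) (f₁ pS k₁ k₂) +
        varJ (Jd pS k₁ k₂) (f₂ pS k₁ k₂) + varJ (Jd pS k₁ k₂) (f₁₂ pS k₁ k₂) +
        2 * varJ (Jd pS k₁ k₂) (f₃ k₁) + 2 * varJ (Jd pS k₁ k₂) (f₄ k₂)) / (n * δ ^ 2) +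
      (3 + 4 * η⁻¹) * (2 : ℝ) ^ (-((n : ℝ) * δ)) + 2 * η := by
  have hJ := Jd_nonneg pS k₁ k₂ hp hk₁ hk₂
  have hJ1 := Jd_sum pS k₁ k₂ hp1 hs₁ hs₂
  set J := Jd pS k₁ k₂ with hJdef
  set μ₁ := mu pS k₁ k₂ (f₁ pS k₁ k₂) with hμ₁
  set μ₂ := mu pS k₁ k₂ (f₂ pS k₁ k₂) with hμ₂
  set μ₁₂ := mu pS k₁ k₂ (f₁₂ pS k₁ k₂) with hμ₁₂
  set μ₃ := mu pS k₁ k₂ (f₃ k₁) with hμ₃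
  set μ₄ := mu pS k₁ k₂ (f₄ k₂) with hμ₄
  set L₁ : ℝ := (2 : ℝ) ^ ((n : ℝ) * (μ₁ + δ)) with hL₁
  set L₂ : ℝ := (2 : ℝ) ^ ((n : ℝ) * (μ₂ + δ)) with hL₂
  set L : ℝ := (2 : ℝ) ^ ((n : ℝ) * (μ₁₂ + δ)) with hL
  have hL₁0 : 0 < L₁ := by positivity
  have hL₂0 : 0 < L₂ := by positivity
  have hL0 : 0 < L := by positivity
  set Q : (Fin n → U₁) → (Fin n → U₂) → ℝ := fun u₁ u₂ => ∏ i, q12 pS k₁ k₂ (u₁ i, u₂ i) with hQ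
  set Q₁ : (Fin n → U₁) → ℝ := fun u₁ => ∏ i, q1 pS k₁ k₂ (u₁ i) with hQ₁
  set Q₂ : (Fin n → U₂) → ℝ := fun u₂ => ∏ i, q2 pS k₁ k₂ (u₂ i) with hQ₂
  have hQ0 : ∀ u₁ u₂, 0 ≤ Q u₁ u₂ := fun u₁ u₂ =>
    Finset.prod_nonneg fun i _ => pmap_nonneg _ _ hJ _
  set T : (Fin n → U₁) → (Fin n → U₂) → Prop := fun u₁ u₂ =>
    (0 < Q u₁ u₂ ∧ Q₂ u₂ ≤ L₁ * Q u₁ u₂) ∧ Q₁ u₁ ≤ L₂ * Q u₁ u₂ ∧ 1 ≤ L * Q u₁ u₂ with hT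
  have hT₁ : ∀ u₂, ∑ u₁, ind (T u₁ u₂) ≤ L₁ := by
    intro u₂
    refine count_le (fun u₁ => Q u₁ u₂) (fun u₁ => hQ0 _ _) (Q₂ u₂) ?_ _ L₁ hL₁0.le
      (fun u₁ h => h.1)
    simp only [hQ, hQ₂]
    rw [iid_sum_prod (fun i u => q12 pS k₁ k₂ (u, u₂ i))]
    exact Finset.prod_congr rfl fun i _ => q12_sum_left _ _ _ _
  have hT₂ : ∀ u₁, ∑ u₂, ind (T u₁ u₂) ≤ L₂ := by
    intro u₁
    refine count_le (fun u₂ => Q u₁ u₂) (fun u₂ => hQ0 _ _) (Q₁ u₁) ?_ _ L₂ hL₂0.le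
      (fun u₂ h => ⟨h.1.1, h.2.1⟩)
    simp only [hQ, hQ₁]
    rw [iid_sum_prod (fun i u => q12 pS k₁ k₂ (u₁ i, u))]
    exact Finset.prod_congr rfl fun i _ => q12_sum_right _ _ _ _
  have hT₁₂ : ∑ u₁, ∑ u₂, ind (T u₁ u₂) ≤ L := by
    rw [← Fintype.sum_prod_type' (fun u₁ u₂ => ind (T u₁ u₂))]
    refine count_le (fun u : (Fin n → U₁) × (Fin n → U₂) => Q u.1 u.2) (fun u => hQ0 _ _) 1 ?_ _
      L hL0.le (fun u h => ⟨h.1.1, h.2.2⟩)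
    simp only [Fintype.sum_prod_type, hQ]
    rw [Finset.sum_congr rfl fun u₁ _ => iid_sum_prod (fun i u => q12 pS k₁ k₂ (u₁ i, u))]
    simp only [q12_sum_right]
    rw [iid_sum_prod (fun _ u => q1 pS k₁ k₂ u)]
    apply Finset.prod_eq_one
    intro i _
    rw [← q12_sum pS k₁ k₂ hp1 hs₁ hs₂, Fintype.sum_prod_type]
    exact Finset.sum_congr rfl fun u _ => (q12_sum_right _ _ _ _).symm
  -- positivity on the support
  have hq12 : ∀ a, 0 < J a → 0 < q12 pS k₁ k₂ (a.2.2.1, a.2.2.2) := fun a ha =>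
    pmap_pos (fun a : X₁ × X₂ × U₁ × U₂ => (a.2.2.1, a.2.2.2)) _ hJ a ha
  have hq1 : ∀ a, 0 < J a → 0 < q1 pS k₁ k₂ a.2.2.1 := fun a ha =>
    pmap_pos (fun a : X₁ × X₂ × U₁ × U₂ => a.2.2.1) _ hJ a ha
  have hq2 : ∀ a, 0 < J a → 0 < q2 pS k₁ k₂ a.2.2.2 := fun a ha =>
    pmap_pos (fun a : X₁ × X₂ × U₁ × U₂ => a.2.2.2) _ hJ a ha
  -- the atypical events
  have c1 := cheb J hJ hJ1 (f₁ pS k₁ k₂) hδ hn (fun a =>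
      ¬ (0 < Q (fun i => (a i).2.2.1) (fun i => (a i).2.2.2) ∧
        Q₂ (fun i => (a i).2.2.2) ≤ L₁ * Q (fun i => (a i).2.2.1) (fun i => (a i).2.2.2))) (by
    intro a ha hE
    have hpos : 0 < Q (fun i => (a i).2.2.1) (fun i => (a i).2.2.2) :=
      Finset.prod_pos fun i _ => hq12 _ (ha i)
    have h2 := not_le.1 (fun h => hE ⟨hpos, h⟩)
    exact prod_lt_log _ _ (fun i => hq2 _ (ha i)) (fun i => hq12 _ (ha i)) _ h2)
  have c2 := cheb J hJ hJ1 (f₂ pS k₁ k₂) hδ hn (fun a =>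
      ¬ (Q₁ (fun i => (a i).2.2.1) ≤ L₂ * Q (fun i => (a i).2.2.1) (fun i => (a i).2.2.2))) (by
    intro a ha hE
    have h2 := not_le.1 hE
    exact prod_lt_log _ _ (fun i => hq1 _ (ha i)) (fun i => hq12 _ (ha i)) _ h2)
  have c12 := cheb J hJ hJ1 (f₁₂ pS k₁ k₂) hδ hn (fun a =>
      ¬ (1 ≤ L * Q (fun i => (a i).2.2.1) (fun i => (a i).2.2.2))) (by
    intro a ha hE
    have h2 := not_le.1 hE
    exact prod_lt_log (fun _ => 1) _ (fun i => one_pos) (fun i => hq12 _ (ha i)) _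
      (by rw [Finset.prod_const_one]; exact h2))
  have c3 := cheb J hJ hJ1 (f₃ k₁) hδ hn (fun a =>
      (2 : ℝ) ^ ((n : ℝ) * (μ₃ + δ)) < ∏ i, k₁ (a i).1 (a i).2.2.1) (by
    intro a ha hE
    exact prod_lt_log _ (fun _ => 1) (fun i => (Jd_pos pS k₁ k₂ hp hk₁ hk₂ (ha i)).2.1)
      (fun i => one_pos) _ (by rw [Finset.prod_const_one, mul_one]; exact hE))
  have c4 := cheb J hJ hJ1 (f₄ k₂) hδ hn (fun a =>
      (2 : ℝ) ^ ((n : ℝ) * (μ₄ + δ)) < ∏ i, k₂ (a i).2.1 (a i).2.2.2) (by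
    intro a ha hE
    exact prod_lt_log _ (fun _ => 1) (fun i => (Jd_pos pS k₁ k₂ hp hk₁ hk₂ (ha i)).2.2)
      (fun i => one_pos) _ (by rw [Finset.prod_const_one, mul_one]; exact hE))
  have c5 := cheb J hJ hJ1 f₅ hδ hn (fun a =>
      n * (mu pS k₁ k₂ f₅ + δ) < ∑ i, f₅ (a i)) (fun a _ h => h.le)
  have c6 := cheb J hJ hJ1 f₆ hδ hn (fun a =>
      n * (mu pS k₁ k₂ f₆ + δ) < ∑ i, f₆ (a i)) (fun a _ h => h.le)
  -- block kernels
  set pn : (Fin n → X₁) × (Fin n → X₂) → ℝ := fun x => ∏ i, pS (x.1 i, x.2 i) with hpn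
  set kn₁ : (Fin n → X₁) → (Fin n → U₁) → ℝ := fun x u => ∏ i, k₁ (x i) (u i) with hkn₁
  set kn₂ : (Fin n → X₂) → (Fin n → U₂) → ℝ := fun x u => ∏ i, k₂ (x i) (u i) with hkn₂
  have hpn0 : ∀ x, 0 ≤ pn x := fun x => Finset.prod_nonneg fun i _ => hp _
  have hkn₁0 : ∀ x u, 0 ≤ kn₁ x u := fun x u => Finset.prod_nonneg fun i _ => hk₁ _ _
  have hkn₂0 : ∀ x u, 0 ≤ kn₂ x u := fun x u => Finset.prod_nonneg fun i _ => hk₂ _ _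
  have hkn₁1 : ∀ x, ∑ u, kn₁ x u = 1 := by
    intro x
    simp only [hkn₁]
    rw [iid_sum_prod (fun i u => k₁ (x i) u)]
    simp [hs₁]
  have hkn₂1 : ∀ x, ∑ u, kn₂ x u = 1 := by
    intro x
    simp only [hkn₂]
    rw [iid_sum_prod (fun i u => k₂ (x i) u)]
    simp [hs₂]
  have hpn1 : ∑ x, pn x = 1 := by
    have h := block_sum pS k₁ k₂ (n := n) (fun _ _ _ => 1)
    simp only [mul_one] at h
    rw [iid_total J hJ1] at h
    rw [← h]
    refine Finset.sum_congr rfl fun x _ => ?_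
    have := hkn₁1 x.1
    have := hkn₂1 x.2
    simp only [hkn₁, hkn₂] at *
    simp only [← Finset.mul_sum, *, mul_one]
  have hv₃ : ∑ x, pn x * (∑ u, if (2 : ℝ) ^ ((n : ℝ) * (μ₃ + δ)) < kn₁ x.1 u then kn₁ x.1 u
      else 0) ≤ varJ J (f₃ k₁) / (n * δ ^ 2) := by
    refine le_trans (le_of_eq ?_) c3
    rw [← block_sum pS k₁ k₂ (n := n) (fun x u₁ _ =>
      ind ((2 : ℝ) ^ ((n : ℝ) * (μ₃ + δ)) < ∏ i, k₁ (x.1 i) (u₁ i)))]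
    refine Finset.sum_congr rfl fun x _ => ?_
    congr 1
    refine Finset.sum_congr rfl fun u _ => ?_
    change _ = ∑ u₂, kn₁ x.1 u * kn₂ x.2 u₂ * ind ((2 : ℝ) ^ ((n : ℝ) * (μ₃ + δ)) < kn₁ x.1 u)
    rw [← Finset.sum_mul, ← Finset.mul_sum, hkn₂1, ind]
    split_ifs <;> simp
  have hv₄ : ∑ x, pn x * (∑ u, if (2 : ℝ) ^ ((n : ℝ) * (μ₄ + δ)) < kn₂ x.2 u then kn₂ x.2 u
      else 0) ≤ varJ J (f₄ k₂) / (n * δ ^ 2) := by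
    refine le_trans (le_of_eq ?_) c4
    rw [← block_sum pS k₁ k₂ (n := n) (fun x _ u₂ =>
      ind ((2 : ℝ) ^ ((n : ℝ) * (μ₄ + δ)) < ∏ i, k₂ (x.2 i) (u₂ i)))]
    refine Finset.sum_congr rfl fun x _ => ?_
    congr 1
    rw [Finset.sum_comm]
    refine Finset.sum_congr rfl fun u _ => ?_
    change _ = ∑ u₁, kn₁ x.1 u₁ * kn₂ x.2 u * ind ((2 : ℝ) ^ ((n : ℝ) * (μ₄ + δ)) < kn₂ x.2 u)
    rw [← Finset.sum_mul, ← Finset.sum_mul, hkn₁1, ind]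
    split_ifs <;> simp
  have : Nonempty (Fin (nMsg n R₁)) := ⟨⟨0, nMsg_pos _ _⟩⟩
  have : Nonempty (Fin (nMsg n R₂)) := ⟨⟨0, nMsg_pos _ _⟩⟩
  have : Nonempty (Fin (nMsg n (-μ₃ - 2 * δ))) := ⟨⟨0, nMsg_pos _ _⟩⟩
  have : Nonempty (Fin (nMsg n (-μ₄ - 2 * δ))) := ⟨⟨0, nMsg_pos _ _⟩⟩
  have t₁ := theta_bound (F := Fin (nMsg n (-μ₃ - 2 * δ))) (M := Fin (nMsg n R₁)) pn hpn0 hpn1 (fun x => kn₁ x.1)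
    (fun x => hkn₁0 x.1) (fun x => hkn₁1 x.1) n μ₃ δ η _ hη (Fintype.card_fin _) hv₃
  have t₂ := theta_bound (F := Fin (nMsg n (-μ₄ - 2 * δ))) (M := Fin (nMsg n R₂)) pn hpn0 hpn1 (fun x => kn₂ x.2)
    (fun x => hkn₂0 x.2) (fun x => hkn₂1 x.2) n μ₄ δ η _ hη (Fintype.card_fin _) hv₄
  obtain ⟨e₁, e₂, dec, he₁, he₁', he₂, he₂', hfin⟩ := oneshot pn hpn0 hpn1 kn₁ kn₂ hkn₁0 hkn₂0
    hkn₁1 hkn₂1 T L₁ L₂ L hT₁ hT₂ hT₁₂ _ _ t₁ t₂ (fun x u₁ u₂ =>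
      n * (mu pS k₁ k₂ f₅ + δ) < ∑ i, f₅ (x.1 i, x.2 i, u₁ i, u₂ i) ∨
      n * (mu pS k₁ k₂ f₆ + δ) < ∑ i, f₆ (x.1 i, x.2 i, u₁ i, u₂ i))
  refine ⟨e₁, e₂, dec, he₁, he₁', he₂, he₂', hfin.trans ?_⟩
  -- typicality term
  have hB := block_sum pS k₁ k₂ (n := n) (fun x u₁ u₂ =>
    ind ((n * (mu pS k₁ k₂ f₅ + δ) < ∑ i, f₅ (x.1 i, x.2 i, u₁ i, u₂ i) ∨
      n * (mu pS k₁ k₂ f₆ + δ) < ∑ i, f₆ (x.1 i, x.2 i, u₁ i, u₂ i)) ∨ ¬ T u₁ u₂))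
  rw [hB]
  have hB2 : ∑ a : Fin n → X₁ × X₂ × U₁ × U₂, (∏ i, Jd pS k₁ k₂ (a i)) *
      ind ((n * (mu pS k₁ k₂ f₅ + δ) < ∑ i, f₅ (a i) ∨
        n * (mu pS k₁ k₂ f₆ + δ) < ∑ i, f₆ (a i)) ∨
        ¬ T (fun i => (a i).2.2.1) (fun i => (a i).2.2.2)) ≤
      varJ J f₅ / (n * δ ^ 2) + varJ J f₆ / (n * δ ^ 2) + varJ J (f₁ pS k₁ k₂) / (n * δ ^ 2) +
      varJ J (f₂ pS k₁ k₂) / (n * δ ^ 2) + varJ J (f₁₂ pS k₁ k₂) / (n * δ ^ 2) := by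
    refine le_trans ?_ (add_le_add (add_le_add (add_le_add (add_le_add c5 c6) c1) c2) c12)
    simp only [← Finset.sum_add_distrib, ← mul_add]
    refine Finset.sum_le_sum fun a _ => mul_le_mul_of_nonneg_left ?_
      (Finset.prod_nonneg fun i _ => hJ _)
    simp only [hT, not_and_or (b := _ ∧ _), not_and_or (a := Q₁ _ ≤ _)]
    refine (ind_or _ _).trans ?_
    have o1 := ind_or (n * (mu pS k₁ k₂ f₅ + δ) < ∑ i, f₅ (a i))
      (n * (mu pS k₁ k₂ f₆ + δ) < ∑ i, f₆ (a i))
    refine (add_le_add o1 ((ind_or _ _).trans (add_le_add le_rfl (ind_or _ _)))).trans ?_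
    linarith
  refine (add_le_add (add_le_add hB2 le_rfl) le_rfl).trans ?_
  -- exponential terms
  set w : ℝ := (2 : ℝ) ^ (-((n : ℝ) * δ)) with hw
  have K₁ : (2 : ℝ) ^ ((n : ℝ) * (-μ₃ - 2 * δ + R₁)) ≤
      (Fintype.card (Fin (nMsg n (-μ₃ - 2 * δ)) × Fin (nMsg n R₁)) : ℝ) := by
    rw [Fintype.card_prod, Fintype.card_fin, Fintype.card_fin, mul_add,
      Real.rpow_add (by norm_num)]
    push_cast
    exact mul_le_mul (nMsg_lb _ _) (nMsg_lb _ _) (by positivity) (by positivity)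
  have K₂ : (2 : ℝ) ^ ((n : ℝ) * (-μ₄ - 2 * δ + R₂)) ≤
      (Fintype.card (Fin (nMsg n (-μ₄ - 2 * δ)) × Fin (nMsg n R₂)) : ℝ) := by
    rw [Fintype.card_prod, Fintype.card_fin, Fintype.card_fin, mul_add,
      Real.rpow_add (by norm_num)]
    push_cast
    exact mul_le_mul (nMsg_lb _ _) (nMsg_lb _ _) (by positivity) (by positivity)
  set N₁ : ℝ := (Fintype.card (Fin (nMsg n (-μ₃ - 2 * δ)) × Fin (nMsg n R₁)) : ℝ)
  set N₂ : ℝ := (Fintype.card (Fin (nMsg n (-μ₄ - 2 * δ)) × Fin (nMsg n R₂)) : ℝ)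
  have i₁ : N₁⁻¹ ≤ (2 : ℝ) ^ (-((n : ℝ) * (-μ₃ - 2 * δ + R₁))) := by
    rw [Real.rpow_neg (by norm_num)]
    exact inv_anti₀ (by positivity) K₁
  have i₂ : N₂⁻¹ ≤ (2 : ℝ) ^ (-((n : ℝ) * (-μ₄ - 2 * δ + R₂))) := by
    rw [Real.rpow_neg (by norm_num)]
    exact inv_anti₀ (by positivity) K₂
  have hn' : (0 : ℝ) < n := by exact_mod_cast hn
  have hN₁ : 0 ≤ N₁⁻¹ := by positivity
  have hN₂ : 0 ≤ N₂⁻¹ := by positivity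
  have x₁ : L₁ * N₁⁻¹ ≤ w := by
    refine (mul_le_mul_of_nonneg_left i₁ hL₁0.le).trans ?_
    rw [hL₁, hw, ← Real.rpow_add (by norm_num)]
    apply Real.rpow_le_rpow_of_exponent_le (by norm_num)
    nlinarith
  have x₂ : L₂ * N₂⁻¹ ≤ w := by
    refine (mul_le_mul_of_nonneg_left i₂ hL₂0.le).trans ?_
    rw [hL₂, hw, ← Real.rpow_add (by norm_num)]
    apply Real.rpow_le_rpow_of_exponent_le (by norm_num)
    nlinarith
  have x₁₂ : L * (N₁⁻¹ * N₂⁻¹) ≤ w := by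
    refine (mul_le_mul_of_nonneg_left (mul_le_mul i₁ i₂ hN₂ (by positivity)) hL0.le).trans ?_
    rw [hL, hw, ← Real.rpow_add (by norm_num), ← Real.rpow_add (by norm_num)]
    apply Real.rpow_le_rpow_of_exponent_le (by norm_num)
    nlinarith
  have : (varJ J f₅ + varJ J f₆ + varJ J (f₁ pS k₁ k₂) +
        varJ J (f₂ pS k₁ k₂) + varJ J (f₁₂ pS k₁ k₂) +
        2 * varJ J (f₃ k₁) + 2 * varJ J (f₄ k₂)) / (n * δ ^ 2) =
      varJ J f₅ / (n * δ ^ 2) + varJ J f₆ / (n * δ ^ 2) + varJ J (f₁ pS k₁ k₂) / (n * δ ^ 2) +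
      varJ J (f₂ pS k₁ k₂) / (n * δ ^ 2) + varJ J (f₁₂ pS k₁ k₂) / (n * δ ^ 2) +
      2 * (varJ J (f₃ k₁) / (n * δ ^ 2)) + 2 * (varJ J (f₄ k₂) / (n * δ ^ 2)) := by ring
  rw [this]
  linarith

end block

/-! ### Part F: passage to the coding formulation -/

lemma tsum_red {A B : Type} [Fintype A] [Fintype B] (N₁ N₂ : ℕ) (F : A × B × ℕ × ℕ → ℝ)
    (hF : ∀ a, ¬ a.2.2.1 < N₁ ∨ ¬ a.2.2.2 < N₂ → F a = 0) :
    ∑' a, F a = ∑ x : A × B, ∑ m₁ : Fin N₁, ∑ m₂ : Fin N₂, F (x.1, x.2, m₁, m₂) := by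
  let g : (A × B) × Fin N₁ × Fin N₂ → A × B × ℕ × ℕ :=
    fun y => (y.1.1, y.1.2, y.2.1.val, y.2.2.val)
  have hg : Function.Injective g := by
    rintro ⟨⟨a, b⟩, c, d⟩ ⟨⟨a', b'⟩, c', d'⟩ h
    simp only [g, Prod.mk.injEq, Fin.val_inj] at h
    simp [h]
  rw [← hg.tsum_eq (f := F), tsum_fintype]
  · simp only [Fintype.sum_prod_type, g]
  · rintro ⟨a, b, m₁, m₂⟩ h
    by_contra hc
    apply h
    apply hF
    by_contra hh
    push Not at hh
    exact hc ⟨((a, b), ⟨m₁, hh.1⟩, ⟨m₂, hh.2⟩), rfl⟩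

lemma isPmf_sum {A : Type} [Fintype A] {p : A → ℝ} (h : IsPmf p) : ∑ a, p a = 1 :=
  (hasSum_fintype p).unique h.2

/-- Extend an encoder to `ℕ` by zero. -/
def extN {X : Type} {N : ℕ} (e : X → Fin N → ℝ) : X → ℕ → ℝ :=
  fun x m => if h : m < N then e x ⟨m, h⟩ else 0

lemma extN_val {X : Type} {N : ℕ} (e : X → Fin N → ℝ) (x : X) (m : Fin N) :
    extN e x m = e x m := by
  simp [extN]

lemma extN_zero {X : Type} {N : ℕ} (e : X → Fin N → ℝ) (x : X) (m : ℕ) (h : ¬ m < N) :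
    extN e x m = 0 := by
  simp [extN, h]

lemma extN_pmf {X : Type} {N : ℕ} (e : X → Fin N → ℝ) (h0 : ∀ x m, 0 ≤ e x m)
    (h1 : ∀ x, ∑ m, e x m = 1) (x : X) : IsPmf (extN e x) := by
  refine ⟨fun m => ?_, ?_⟩
  · unfold extN
    split_ifs
    · exact h0 _ _
    · exact le_rfl
  · rw [← Function.Injective.hasSum_iff (g := (Fin.val : Fin N → ℕ)) Fin.val_injective]
    · rw [← h1 x]
      have : extN e x ∘ Fin.val = e x := funext fun m => extN_val e x m
      rw [this]
      exact hasSum_fintype _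
    · intro m hm
      apply extN_zero
      intro hlt
      exact hm ⟨⟨m, hlt⟩, rfl⟩

lemma dist_bound {X₁ X₂ M₁ M₂ : Type} [Fintype X₁] [Fintype X₂] [Fintype M₁] [Fintype M₂]
    (p : X₁ × X₂ → ℝ) (hp : ∀ x, 0 ≤ p x) (hp1 : ∑ x, p x = 1)
    (e₁ : X₁ → M₁ → ℝ) (e₂ : X₂ → M₂ → ℝ) (he₁ : ∀ x m, 0 ≤ e₁ x m) (he₂ : ∀ x m, 0 ≤ e₂ x m)
    (hs₁ : ∀ x, ∑ m, e₁ x m = 1) (hs₂ : ∀ x, ∑ m, e₂ x m = 1)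
    (B : X₁ × X₂ → M₁ → M₂ → Prop) (v : ℝ)
    (hv : ∑ x, p x * ∑ m₁, ∑ m₂, e₁ x.1 m₁ * e₂ x.2 m₂ * ind (B x m₁ m₂) ≤ v)
    (d : X₁ × X₂ → M₁ → M₂ → ℝ) (c K : ℝ) (hK : 0 ≤ K)
    (hd : ∀ x m₁ m₂, d x m₁ m₂ ≤ c + K * ind (B x m₁ m₂)) :
    ∑ x, ∑ m₁, ∑ m₂, p x * e₁ x.1 m₁ * e₂ x.2 m₂ * d x m₁ m₂ ≤ c + K * v := by
  have h1 : ∑ x, ∑ m₁, ∑ m₂, p x * e₁ x.1 m₁ * e₂ x.2 m₂ = 1 := by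
    simp only [← Finset.mul_sum, hs₂, mul_one, hs₁, hp1]
  calc ∑ x, ∑ m₁, ∑ m₂, p x * e₁ x.1 m₁ * e₂ x.2 m₂ * d x m₁ m₂
      ≤ ∑ x, ∑ m₁, ∑ m₂, p x * e₁ x.1 m₁ * e₂ x.2 m₂ * (c + K * ind (B x m₁ m₂)) := by
        refine Finset.sum_le_sum fun x _ => Finset.sum_le_sum fun m₁ _ =>
          Finset.sum_le_sum fun m₂ _ => mul_le_mul_of_nonneg_left (hd _ _ _)
            (mul_nonneg (mul_nonneg (hp _) (he₁ _ _)) (he₂ _ _))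
    _ = c * ∑ x, ∑ m₁, ∑ m₂, p x * e₁ x.1 m₁ * e₂ x.2 m₂ +
        K * ∑ x, p x * ∑ m₁, ∑ m₂, e₁ x.1 m₁ * e₂ x.2 m₂ * ind (B x m₁ m₂) := by
        simp only [Finset.mul_sum, ← Finset.sum_add_distrib]
        refine Finset.sum_congr rfl fun x _ => Finset.sum_congr rfl fun m₁ _ =>
          Finset.sum_congr rfl fun m₂ _ => by ring
    _ ≤ c + K * v := by
        rw [h1, mul_one]
        exact add_le_add le_rfl (mul_le_mul_of_nonneg_left hv hK)

lemma choose_n (C K δ ε : ℝ) (hδ : 0 < δ) (hε : 0 < ε) :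
    ∃ n : ℕ, 0 < n ∧ C / (n * δ ^ 2) + K * (2 : ℝ) ^ (-((n : ℝ) * δ)) ≤ ε := by
  have h1 : Filter.Tendsto (fun n : ℕ => C / ((n : ℝ) * δ ^ 2)) Filter.atTop (nhds 0) :=
    Filter.Tendsto.const_div_atTop
      (tendsto_natCast_atTop_atTop.atTop_mul_const (by positivity)) C
  have h2 : Filter.Tendsto (fun n : ℕ => K * (2 : ℝ) ^ (-((n : ℝ) * δ))) Filter.atTop
      (nhds (K * 0)) := by
    apply Filter.Tendsto.const_mul
    exact (tendsto_rpow_atBot_of_base_gt_one (2 : ℝ) (by norm_num)).comp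
      (Filter.tendsto_neg_atTop_atBot.comp (tendsto_natCast_atTop_atTop.atTop_mul_const hδ))
  have h3 := h1.add h2
  rw [mul_zero, add_zero] at h3
  have h4 := (h3.eventually (Iio_mem_nhds hε)).and (Filter.eventually_gt_atTop 0)
  obtain ⟨n, hn, hn0⟩ := h4.exists
  exact ⟨n, hn0, le_of_lt hn⟩

lemma avg_bound {n : ℕ} (hn : 0 < n) (f : Fin n → ℝ) (m D K δ ε : ℝ) (hD : m ≤ D) (hδ : δ ≤ ε)
    (hf0 : 0 ≤ D) (hε : 0 ≤ ε) (hfK : ∀ i, f i ≤ K) (hK : 0 ≤ K) (B : Prop)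
    (hB : n * (m + δ) < ∑ i, f i → B) :
    (n : ℝ)⁻¹ * ∑ i, f i ≤ (D + ε) + K * ind B := by
  have hn' : (0 : ℝ) < n := by exact_mod_cast hn
  by_cases h : B
  · rw [ind_true h, mul_one]
    have h1 : ∑ i, f i ≤ n * K := by
      refine (Finset.sum_le_sum fun i _ => hfK i).trans ?_
      simp
    have h2 : (n : ℝ)⁻¹ * ∑ i, f i ≤ K := by
      rw [inv_mul_le_iff₀ hn']
      exact h1
    linarith
  · have h1 := not_lt.1 (fun h' => h (hB h'))
    rw [ind_false h, mul_zero, add_zero, inv_mul_le_iff₀ hn']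
    exact h1.trans (mul_le_mul_of_nonneg_left (by linarith) hn'.le)

set_option maxHeartbeats 2000000 in
/-- Berger–Tung inner bound for distributed lossy compression.  If there are
finite auxiliaries `U₁, U₂` with `U₁ − X₁ − X₂ − U₂` (i.e. joint pmf
`p(x₁,x₂) p(u₁|x₁) p(u₂|x₂)`), decoding functions `x̂_j(u₁,u₂)` meeting the distortions
`E d_j(X_j, X̂_j) ≤ D_j`, and `R₁ > I(X₁;U₁|U₂)`, `R₂ > I(X₂;U₂|U₁)`,
`R₁ + R₂ > I(X₁,X₂;U₁,U₂)`, then `(R₁,R₂)` is achievable at distortions `(D₁,D₂)`: for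
every `ε > 0` there are `n`, stochastic encoders at rates `R₁, R₂` and a decoder whose
expected average per-letter distortions are at most `D_j + ε`. -/
theorem berger_tung_achievability
    {𝒳₁ 𝒳₂ 𝒳h₁ 𝒳h₂ 𝒰₁ 𝒰₂ : Type}
    [Fintype 𝒳₁] [Fintype 𝒳₂] [Fintype 𝒳h₁] [Fintype 𝒳h₂] [Fintype 𝒰₁] [Fintype 𝒰₂]
    [Nonempty 𝒳₁] [Nonempty 𝒳₂] [Nonempty 𝒳h₁] [Nonempty 𝒳h₂]
    (d₁max d₂max : ℝ)
    (d₁ : 𝒳₁ × 𝒳h₁ → ℝ) (d₂ : 𝒳₂ × 𝒳h₂ → ℝ)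
    (hd₁ : ∀ a, d₁ a ∈ Set.Icc 0 d₁max) (hd₂ : ∀ a, d₂ a ∈ Set.Icc 0 d₂max)
    (pS : 𝒳₁ × 𝒳₂ → ℝ) (hpS : IsPmf pS)
    (k₁ : 𝒳₁ → 𝒰₁ → ℝ) (k₂ : 𝒳₂ → 𝒰₂ → ℝ)
    (hk₁ : ∀ x, IsPmf (k₁ x)) (hk₂ : ∀ x, IsPmf (k₂ x))
    (g₁ : 𝒰₁ × 𝒰₂ → 𝒳h₁) (g₂ : 𝒰₁ × 𝒰₂ → 𝒳h₂)
    (D₁ D₂ R₁ R₂ : ℝ)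
    -- the joint pmf is J(x₁,x₂,u₁,u₂) = pS(x₁,x₂) k₁(u₁|x₁) k₂(u₂|x₂)
    (hdist₁ : (∑' a : 𝒳₁ × 𝒳₂ × 𝒰₁ × 𝒰₂,
        pS (a.1, a.2.1) * k₁ a.1 a.2.2.1 * k₂ a.2.1 a.2.2.2 *
          d₁ (a.1, g₁ (a.2.2.1, a.2.2.2))) ≤ D₁)
    (hdist₂ : (∑' a : 𝒳₁ × 𝒳₂ × 𝒰₁ × 𝒰₂,
        pS (a.1, a.2.1) * k₁ a.1 a.2.2.1 * k₂ a.2.1 a.2.2.2 *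
          d₂ (a.2.1, g₂ (a.2.2.1, a.2.2.2))) ≤ D₂)
    (hR₁ : CMI (pmap (fun a : 𝒳₁ × 𝒳₂ × 𝒰₁ × 𝒰₂ => (a.1, a.2.2.1, a.2.2.2))
        (fun a => pS (a.1, a.2.1) * k₁ a.1 a.2.2.1 * k₂ a.2.1 a.2.2.2)) < R₁)
    (hR₂ : CMI (pmap (fun a : 𝒳₁ × 𝒳₂ × 𝒰₁ × 𝒰₂ => (a.2.1, a.2.2.2, a.2.2.1))
        (fun a => pS (a.1, a.2.1) * k₁ a.1 a.2.2.1 * k₂ a.2.1 a.2.2.2)) < R₂)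
    (hR₁₂ : MI (pmap (fun a : 𝒳₁ × 𝒳₂ × 𝒰₁ × 𝒰₂ => ((a.1, a.2.1), (a.2.2.1, a.2.2.2)))
        (fun a => pS (a.1, a.2.1) * k₁ a.1 a.2.2.1 * k₂ a.2.1 a.2.2.2)) < R₁ + R₂) :
    ∀ ε > (0 : ℝ), ∃ (n : ℕ) (enc₁ : (Fin n → 𝒳₁) → ℕ → ℝ) (enc₂ : (Fin n → 𝒳₂) → ℕ → ℝ)
      (dec : ℕ × ℕ → (Fin n → 𝒳h₁) × (Fin n → 𝒳h₂)),
      0 < n ∧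
      (∀ x, IsPmf (enc₁ x) ∧ ∀ m, ¬ m < nMsg n R₁ → enc₁ x m = 0) ∧
      (∀ x, IsPmf (enc₂ x) ∧ ∀ m, ¬ m < nMsg n R₂ → enc₂ x m = 0) ∧
      (∑' a : (Fin n → 𝒳₁) × (Fin n → 𝒳₂) × ℕ × ℕ,
          (∏ i, pS (a.1 i, a.2.1 i)) * enc₁ a.1 a.2.2.1 * enc₂ a.2.1 a.2.2.2 *
            ((n : ℝ)⁻¹ * ∑ i, d₁ (a.1 i, (dec (a.2.2.1, a.2.2.2)).1 i))) ≤ D₁ + ε ∧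
      (∑' a : (Fin n → 𝒳₁) × (Fin n → 𝒳₂) × ℕ × ℕ,
          (∏ i, pS (a.1 i, a.2.1 i)) * enc₁ a.1 a.2.2.1 * enc₂ a.2.1 a.2.2.2 *
            ((n : ℝ)⁻¹ * ∑ i, d₂ (a.2.1 i, (dec (a.2.2.1, a.2.2.2)).2 i))) ≤ D₂ + ε := by
  intro ε hε
  have hp0 := hpS.1
  have hp1 := isPmf_sum hpS
  have hk₁0 := fun x => (hk₁ x).1
  have hk₂0 := fun x => (hk₂ x).1
  have hs₁ := fun x => isPmf_sum (hk₁ x)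
  have hs₂ := fun x => isPmf_sum (hk₂ x)
  have hU₁ : Nonempty 𝒰₁ := by
    by_contra h
    rw [not_nonempty_iff] at h
    have := hs₁ (Classical.arbitrary _)
    simp at this
  have hU₂ : Nonempty 𝒰₂ := by
    by_contra h
    rw [not_nonempty_iff] at h
    have := hs₂ (Classical.arbitrary _)
    simp at this
  have hm₁ : 0 ≤ d₁max :=
    (hd₁ (Classical.arbitrary _)).1.trans (hd₁ (Classical.arbitrary _)).2
  have hm₂ : 0 ≤ d₂max :=
    (hd₂ (Classical.arbitrary _)).1.trans (hd₂ (Classical.arbitrary _)).2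
  set f₅ : 𝒳₁ × 𝒳₂ × 𝒰₁ × 𝒰₂ → ℝ := fun a => d₁ (a.1, g₁ (a.2.2.1, a.2.2.2)) with hf₅
  set f₆ : 𝒳₁ × 𝒳₂ × 𝒰₁ × 𝒰₂ → ℝ := fun a => d₂ (a.2.1, g₂ (a.2.2.1, a.2.2.2)) with hf₆
  have hJ := Jd_nonneg pS k₁ k₂ hp0 hk₁0 hk₂0
  have hD₁ : mu pS k₁ k₂ f₅ ≤ D₁ := by
    rw [tsum_fintype] at hdist₁
    exact hdist₁
  have hD₂ : mu pS k₁ k₂ f₆ ≤ D₂ := by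
    rw [tsum_fintype] at hdist₂
    exact hdist₂
  have hD₁0 : 0 ≤ D₁ := le_trans
    (Finset.sum_nonneg fun a _ => mul_nonneg (hJ a) (hd₁ _).1) hD₁
  have hD₂0 : 0 ≤ D₂ := le_trans
    (Finset.sum_nonneg fun a _ => mul_nonneg (hJ a) (hd₂ _).1) hD₂
  have r₁ := (cmi1 pS k₁ k₂ hp0 hk₁0 hk₂0 hs₁).symm.trans_lt hR₁
  have r₂ := (cmi2 pS k₁ k₂ hp0 hk₁0 hk₂0 hs₂).symm.trans_lt hR₂
  have r₁₂ := (mi12 pS k₁ k₂ hp0 hk₁0 hk₂0 hs₁ hs₂).symm.trans_lt hR₁₂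
  set γ₁ := mu pS k₁ k₂ (f₁ pS k₁ k₂) + mu pS k₁ k₂ (f₃ k₁) with hγ₁
  set γ₂ := mu pS k₁ k₂ (f₂ pS k₁ k₂) + mu pS k₁ k₂ (f₄ k₂) with hγ₂
  set γ₁₂ := mu pS k₁ k₂ (f₁₂ pS k₁ k₂) + mu pS k₁ k₂ (f₃ k₁) + mu pS k₁ k₂ (f₄ k₂) with hγ₁₂
  obtain ⟨δ, hδ, hδ₁, hδ₂, hδ₁₂, hδε⟩ : ∃ δ : ℝ, 0 < δ ∧ γ₁ + 4 * δ ≤ R₁ ∧ γ₂ + 4 * δ ≤ R₂ ∧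
      γ₁₂ + 6 * δ ≤ R₁ + R₂ ∧ δ ≤ ε / 2 := by
    refine ⟨min (min ((R₁ - γ₁) / 4) ((R₂ - γ₂) / 4)) (min ((R₁ + R₂ - γ₁₂) / 6) (ε / 2)),
      ?_, ?_, ?_, ?_, ?_⟩
    · refine lt_min (lt_min ?_ ?_) (lt_min ?_ ?_) <;> linarith
    · linarith [(min_le_left (min ((R₁ - γ₁) / 4) ((R₂ - γ₂) / 4))
        (min ((R₁ + R₂ - γ₁₂) / 6) (ε / 2))).trans (min_le_left _ _)]
    · linarith [(min_le_left (min ((R₁ - γ₁) / 4) ((R₂ - γ₂) / 4))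
        (min ((R₁ + R₂ - γ₁₂) / 6) (ε / 2))).trans (min_le_right _ _)]
    · linarith [(min_le_right (min ((R₁ - γ₁) / 4) ((R₂ - γ₂) / 4))
        (min ((R₁ + R₂ - γ₁₂) / 6) (ε / 2))).trans (min_le_left _ _)]
    · exact (min_le_right _ _).trans (min_le_right _ _)
  set ε' : ℝ := ε / (2 * (d₁max + d₂max + 1)) with hε'
  have hε'0 : 0 < ε' := by positivity
  have hden : ε' * (2 * (d₁max + d₂max + 1)) = ε := div_mul_cancel₀ _ (by positivity)
  have hb₁ : d₁max * ε' ≤ ε / 2 := by nlinarith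
  have hb₂ : d₂max * ε' ≤ ε / 2 := by nlinarith
  obtain ⟨n, hn, hnb⟩ := choose_n
    (varJ (Jd pS k₁ k₂) f₅ + varJ (Jd pS k₁ k₂) f₆ + varJ (Jd pS k₁ k₂) (f₁ pS k₁ k₂) +
        varJ (Jd pS k₁ k₂) (f₂ pS k₁ k₂) + varJ (Jd pS k₁ k₂) (f₁₂ pS k₁ k₂) +
        2 * varJ (Jd pS k₁ k₂) (f₃ k₁) + 2 * varJ (Jd pS k₁ k₂) (f₄ k₂))
    (3 + 4 * (ε' / 4)⁻¹) δ (ε' / 2) hδ (by positivity)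
  obtain ⟨e₁, e₂, dec, he₁, he₁s, he₂, he₂s, hbad⟩ := nfold pS k₁ k₂ hp0 hp1 hk₁0 hk₂0 hs₁ hs₂
    R₁ R₂ δ (ε' / 4) hδ (by positivity) hδ₁ hδ₂ hδ₁₂ f₅ f₆ n hn
  let Bad : (Fin n → 𝒳₁) × (Fin n → 𝒳₂) → Fin (nMsg n R₁) → Fin (nMsg n R₂) → Prop :=
    fun x m₁ m₂ => n * (mu pS k₁ k₂ f₅ + δ) <
        ∑ i, f₅ (x.1 i, x.2 i, (dec m₁ m₂).1 i, (dec m₁ m₂).2 i) ∨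
      n * (mu pS k₁ k₂ f₆ + δ) < ∑ i, f₆ (x.1 i, x.2 i, (dec m₁ m₂).1 i, (dec m₁ m₂).2 i)
  have hv : ∑ x : (Fin n → 𝒳₁) × (Fin n → 𝒳₂), (∏ i, pS (x.1 i, x.2 i)) *
        ∑ m₁, ∑ m₂, e₁ x.1 m₁ * e₂ x.2 m₂ * ind (Bad x m₁ m₂) ≤ ε' :=
    hbad.trans (by linarith)
  have hpn0 : ∀ x : (Fin n → 𝒳₁) × (Fin n → 𝒳₂), 0 ≤ ∏ i, pS (x.1 i, x.2 i) :=
    fun x => Finset.prod_nonneg fun i _ => hp0 _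
  have hpn1 : ∑ x : (Fin n → 𝒳₁) × (Fin n → 𝒳₂), ∏ i, pS (x.1 i, x.2 i) = 1 := by
    rw [← iid_total (n := n) pS hp1]
    exact (Equiv.sum_comp (Equiv.arrowProdEquivProdArrow (Fin n) (fun _ => 𝒳₁) (fun _ => 𝒳₂)).symm
      (fun a : Fin n → 𝒳₁ × 𝒳₂ => ∏ i, pS (a i)))
  let decN : ℕ × ℕ → (Fin n → 𝒳h₁) × (Fin n → 𝒳h₂) := fun m =>
    if h : m.1 < nMsg n R₁ ∧ m.2 < nMsg n R₂ then
      (fun i => g₁ ((dec ⟨m.1, h.1⟩ ⟨m.2, h.2⟩).1 i, (dec ⟨m.1, h.1⟩ ⟨m.2, h.2⟩).2 i),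
        fun i => g₂ ((dec ⟨m.1, h.1⟩ ⟨m.2, h.2⟩).1 i, (dec ⟨m.1, h.1⟩ ⟨m.2, h.2⟩).2 i))
    else (fun _ => Classical.arbitrary _, fun _ => Classical.arbitrary _)
  have hdec : ∀ (m₁ : Fin (nMsg n R₁)) (m₂ : Fin (nMsg n R₂)), decN (m₁, m₂) =
      (fun i => g₁ ((dec m₁ m₂).1 i, (dec m₁ m₂).2 i),
        fun i => g₂ ((dec m₁ m₂).1 i, (dec m₁ m₂).2 i)) := by
    intro m₁ m₂
    exact dif_pos ⟨m₁.2, m₂.2⟩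
  refine ⟨n, extN e₁, extN e₂, decN, hn,
    fun x => ⟨extN_pmf e₁ he₁ he₁s x, extN_zero e₁ x⟩,
    fun x => ⟨extN_pmf e₂ he₂ he₂s x, extN_zero e₂ x⟩, ?_, ?_⟩
  · rw [tsum_red (nMsg n R₁) (nMsg n R₂)]
    · simp only [extN_val, hdec]
      have b := dist_bound _ hpn0 hpn1 e₁ e₂ he₁ he₂ he₁s he₂s Bad ε' hv
        (fun x m₁ m₂ => (n : ℝ)⁻¹ * ∑ i, d₁ (x.1 i, g₁ ((dec m₁ m₂).1 i, (dec m₁ m₂).2 i)))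
        (D₁ + ε / 2) d₁max hm₁ (fun x m₁ m₂ =>
          avg_bound hn (fun i => d₁ (x.1 i, g₁ ((dec m₁ m₂).1 i, (dec m₁ m₂).2 i)))
            (mu pS k₁ k₂ f₅) D₁ d₁max δ (ε / 2) hD₁ hδε hD₁0 (by linarith)
            (fun i => (hd₁ _).2) hm₁ (Bad x m₁ m₂) (fun h => Or.inl h))
      exact b.trans (by linarith)
    · rintro ⟨a, b, m₁, m₂⟩ (h | h)
      · simp only [extN_zero e₁ a m₁ h, mul_zero, zero_mul]
      · simp only [extN_zero e₂ b m₂ h, mul_zero, zero_mul]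
  · rw [tsum_red (nMsg n R₁) (nMsg n R₂)]
    · simp only [extN_val, hdec]
      have b := dist_bound _ hpn0 hpn1 e₁ e₂ he₁ he₂ he₁s he₂s Bad ε' hv
        (fun x m₁ m₂ => (n : ℝ)⁻¹ * ∑ i, d₂ (x.2 i, g₂ ((dec m₁ m₂).1 i, (dec m₁ m₂).2 i)))
        (D₂ + ε / 2) d₂max hm₂ (fun x m₁ m₂ =>
          avg_bound hn (fun i => d₂ (x.2 i, g₂ ((dec m₁ m₂).1 i, (dec m₁ m₂).2 i)))
            (mu pS k₁ k₂ f₆) D₂ d₂max δ (ε / 2) hD₂ hδε hD₂0 (by linarith)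
            (fun i => (hd₂ _).2) hm₂ (Bad x m₁ m₂) (fun h => Or.inr h))
      exact b.trans (by linarith)
    · rintro ⟨a, b, m₁, m₂⟩ (h | h)
      · simp only [extN_zero e₁ a m₁ h, mul_zero, zero_mul]
      · simp only [extN_zero e₂ b m₂ h, mul_zero, zero_mul]
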